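/- arXiv:1706.04019 — 4 statements merged into one kernel-verified Lean document; each statement's English description precedes it below -/
import Mathlib

section
/- For any α₁, α₂ ∈ (0,2), define N^∧_{α₁,α₂}(s) := s^{n/(n−α₁/2)} ∧ s^{n/(n−α₂/2)} and N^∨_{α₁,α₂}(s) := s^{n/(n−α₁/2)} ∨ s^{n/(n−α₂/2)} for s ≥ 0. Then there exists a constant C > 0 such that ‖f‖_{N^∧_{α₁,α₂}} ≤ C ∫_{ℝⁿ×ℝⁿ} |f(x) − f(y)| / ( |x−y|^{n+α₁/2} ∨ |x−y|^{n+α₂/2} ) dx dy for all f ∈ L_{N^∧_{α₁,α₂}}(ℝⁿ), and ‖f‖_{N^∨_{α₁,α₂}} ≤ C ∫_{ℝⁿ×ℝⁿ} |f(x) − f(y)| / ( |x−y|^{n+α₁/2} ∧ |x−y|^{n+α₂/2} ) dx dy for all f ∈ L_{N^∨_{α₁,α₂}}(ℝⁿ). -/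
open MeasureTheory ENNReal NNReal Filter Set

noncomputable section

/-- A Young function: a convex, increasing function `N : [0,∞) → [0,∞]` with
`N 0 = 0` and `N(s) → ∞` as `s → ∞`. -/
structure YoungFunction where
  toFun : ℝ≥0 → ℝ≥0∞
  map_zero : toFun 0 = 0
  mono : Monotone toFun
  convex : ∀ (a b t : ℝ≥0), t ≤ 1 →
    toFun (t * a + (1 - t) * b) ≤ (t : ℝ≥0∞) * toFun a + ((1 - t : ℝ≥0) : ℝ≥0∞) * toFun b
  tendsto_top : Tendsto toFun atTop (nhds ⊤)

/-- The Orlicz (Luxemburg) norm `‖f‖_N = inf { r > 0 : ∫ N(|f|/r) dμ ≤ 1 }`,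
with `inf ∅ = ∞`. -/
def orliczNorm {E : Type*} [MeasurableSpace E] (μ : Measure E)
    (N : ℝ≥0 → ℝ≥0∞) (f : E → ℝ) : ℝ≥0∞ :=
  ⨅ (r : ℝ≥0) (_ : 0 < r ∧ ∫⁻ x, N (‖f x‖₊ / r) ∂μ ≤ 1), (r : ℝ≥0∞)

/-- The generalized inverse `F⁻¹(r) = inf { s > 0 : F s ≥ r }` of a nonnegative
increasing function, with `inf ∅ = ∞`. -/
def invIncr (F : ℝ≥0 → ℝ≥0∞) (r : ℝ≥0∞) : ℝ≥0∞ :=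
  ⨅ (s : ℝ≥0) (_ : 0 < s ∧ r ≤ F s), (s : ℝ≥0∞)

/-- `N^∧_{α₁,α₂}(s) = s^{n/(n-α₁/2)} ∧ s^{n/(n-α₂/2)}`. -/
def Nand (n : ℕ) (α₁ α₂ : ℝ) (s : ℝ≥0) : ℝ≥0∞ :=
  min ((s : ℝ≥0∞) ^ ((n : ℝ) / ((n : ℝ) - α₁ / 2)))
    ((s : ℝ≥0∞) ^ ((n : ℝ) / ((n : ℝ) - α₂ / 2)))

/-- `N^∨_{α₁,α₂}(s) = s^{n/(n-α₁/2)} ∨ s^{n/(n-α₂/2)}`. -/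
def Nor (n : ℕ) (α₁ α₂ : ℝ) (s : ℝ≥0) : ℝ≥0∞ :=
  max ((s : ℝ≥0∞) ^ ((n : ℝ) / ((n : ℝ) - α₁ / 2)))
    ((s : ℝ≥0∞) ^ ((n : ℝ) / ((n : ℝ) - α₂ / 2)))

lemma osm_isop (n : ℕ) (hn : 1 ≤ n) (φ : ℝ≥0∞ → ℝ≥0∞) (K : ℝ → ℝ≥0∞) (c : ℝ≥0∞)
    (hφ0 : φ 0 = 0)
    (hK : ∀ r s : ℝ, 0 < r → r ≤ s → K s ≤ K r)
    (hKφ : ∀ (R : ℝ) (m : ℝ≥0∞), 0 < R → m ≠ 0 → m ≠ ∞ →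
      volume (Metric.ball (0 : EuclideanSpace ℝ (Fin n)) R) = 2 * m → c * φ m ≤ m * (m * K R))
    (A : Set (EuclideanSpace ℝ (Fin n))) (hA : MeasurableSet A) (hfin : volume A ≠ ∞) :
    c * φ (volume A) ≤ ∫⁻ x in A, ∫⁻ y in Aᶜ, K (dist x y) := by
  by_cases h0 : volume A = 0
  · simp [h0, hφ0]
  have : Nonempty (Fin n) := ⟨⟨0, hn⟩⟩
  set m := volume A with hm
  set w := volume (Metric.ball (0 : EuclideanSpace ℝ (Fin n)) 1) with hw
  have hw0 : w ≠ 0 := (Metric.measure_ball_pos _ _ one_pos).ne'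
  have hwt : w ≠ ∞ := measure_ball_lt_top.ne
  obtain ⟨R, hR, hRv⟩ : ∃ R : ℝ, 0 < R ∧
      volume (Metric.ball (0 : EuclideanSpace ℝ (Fin n)) R) = 2 * m := by
    have hq : 0 < (2 * m / w).toReal := by
      apply ENNReal.toReal_pos
      · simp [h0, hwt]
      · exact ENNReal.div_ne_top (ENNReal.mul_ne_top (by simp) hfin) hw0
    refine ⟨(2 * m / w).toReal ^ ((n : ℝ)⁻¹), Real.rpow_pos_of_pos hq _, ?_⟩
    rw [Measure.addHaar_ball_of_pos _ _ (Real.rpow_pos_of_pos hq _), finrank_euclideanSpace_fin,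
      Real.rpow_inv_natCast_pow hq.le (by omega), ENNReal.ofReal_toReal]
    · exact ENNReal.div_mul_cancel hw0 hwt
    · exact ENNReal.div_ne_top (ENNReal.mul_ne_top (by simp) hfin) hw0
  have hinner : ∀ x : EuclideanSpace ℝ (Fin n), m * K R ≤ ∫⁻ y in Aᶜ, K (dist x y) := by
    intro x
    have hb : m ≤ volume (Aᶜ ∩ (Metric.ball x R \ {x})) := by
      have h1 : volume (Metric.ball x R) = 2 * m := by
        rw [← hRv, Measure.addHaar_ball_center]
      have h2 : volume (Metric.ball x R) ≤
          volume (Aᶜ ∩ (Metric.ball x R \ {x})) + volume (A ∪ {x}) := by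
        refine (measure_mono ?_).trans (measure_union_le _ _)
        intro y hy
        by_cases hyA : y ∈ A ∪ {x}
        · exact Or.inr hyA
        · left
          simp only [mem_union, not_or, mem_singleton_iff] at hyA
          exact ⟨hyA.1, hy, hyA.2⟩
      have h3 : volume (A ∪ {x}) ≤ m := by
        refine (measure_union_le _ _).trans ?_
        have : Nontrivial (EuclideanSpace ℝ (Fin n)) := inferInstance
        simp [hm]
      rw [h1, two_mul] at h2
      have h4 := h2.trans (add_le_add_right h3 _)
      exact (ENNReal.add_le_add_iff_right hfin).1 h4
    have hms : MeasurableSet (Aᶜ ∩ (Metric.ball x R \ {x})) :=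
      hA.compl.inter (measurableSet_ball.diff (measurableSet_singleton x))
    calc m * K R ≤ K R * volume (Aᶜ ∩ (Metric.ball x R \ {x})) := by
          rw [mul_comm]; gcongr
      _ = ∫⁻ y in Aᶜ ∩ (Metric.ball x R \ {x}), K R := by simp
      _ ≤ ∫⁻ y in Aᶜ ∩ (Metric.ball x R \ {x}), K (dist x y) := by
          refine setLIntegral_mono' hms ?_
          intro y hy
          refine hK _ _ (dist_pos.2 fun h => hy.2.2 h.symm) ?_
          rw [dist_comm]; exact (Metric.mem_ball.1 hy.2.1).le
      _ ≤ _ := lintegral_mono_set inter_subset_left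
  calc c * φ m ≤ m * (m * K R) := hKφ R m hR h0 hfin hRv
    _ = ∫⁻ x in A, m * K R := by simp [hm, mul_comm]
    _ ≤ _ := lintegral_mono fun x => hinner x

lemma osm_core (n : ℕ) (hn : 1 ≤ n) (N : ℝ≥0 → ℝ≥0∞) (h : ℝ → ℝ≥0∞)
    (φ : ℝ≥0∞ → ℝ≥0∞) (K : ℝ → ℝ≥0∞) (c : ℝ≥0∞) (hc0 : c ≠ 0) (hct : c ≠ ∞)
    (hφ0 : φ 0 = 0) (hφm : Monotone φ) (hKm : Measurable K)
    (hh : ∀ s t : ℝ, 0 ≤ s → s ≤ t → h s ≤ h t) (hhm : Measurable h)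
    (hN0 : N 0 = 0)
    (hNh : ∀ s : ℝ, 0 < s → N s.toNNReal ≤ ENNReal.ofReal s * h s)
    (hhφ : ∀ (t : ℝ) (m : ℝ≥0∞), 0 < t → m ≠ ∞ → ENNReal.ofReal t * φ m ≤ 1 → h t * m ≤ φ m)
    (hK : ∀ r s : ℝ, 0 < r → r ≤ s → K s ≤ K r)
    (hKφ : ∀ (R : ℝ) (m : ℝ≥0∞), 0 < R → m ≠ 0 → m ≠ ∞ →
      volume (Metric.ball (0 : EuclideanSpace ℝ (Fin n)) R) = 2 * m → c * φ m ≤ m * (m * K R))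
    (g : EuclideanSpace ℝ (Fin n) → ℝ) (hg : Measurable g) (hg0 : ∀ x, 0 ≤ g x)
    (hfin : ∀ t : ℝ, 0 < t → volume {x | t < g x} ≠ ∞)
    (hD : ∫⁻ x, ∫⁻ y, ENNReal.ofReal (g x - g y) * K (dist x y) ≤ c) :
    ∫⁻ x, N (g x / 2).toNNReal ≤ 1 := by
  have hA : ∀ t : ℝ, MeasurableSet {x | t < g x} := fun t => measurableSet_lt measurable_const hg
  -- coarea
  have hco : c * ∫⁻ t in Ioi (0:ℝ), φ (volume {x | t < g x}) ≤ c := by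
    refine le_trans ?_ hD
    have hF : Measurable fun p : ℝ × EuclideanSpace ℝ (Fin n) × EuclideanSpace ℝ (Fin n) =>
        ({q : ℝ × EuclideanSpace ℝ (Fin n) × EuclideanSpace ℝ (Fin n) |
          q.1 < g q.2.1 ∧ g q.2.2 ≤ q.1}).indicator (fun q => K (dist q.2.1 q.2.2)) p := by
      apply Measurable.indicator
      · exact hKm.comp (by fun_prop)
      · have a1 : Measurable fun q : ℝ × EuclideanSpace ℝ (Fin n) × EuclideanSpace ℝ (Fin n) =>
          g q.2.1 := by fun_prop
        have a2 : Measurable fun q : ℝ × EuclideanSpace ℝ (Fin n) × EuclideanSpace ℝ (Fin n) =>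
          g q.2.2 := by fun_prop
        exact (measurableSet_lt measurable_fst a1).inter (measurableSet_le a2 measurable_fst)
    set F : ℝ → EuclideanSpace ℝ (Fin n) → EuclideanSpace ℝ (Fin n) → ℝ≥0∞ := fun t x y =>
      ({q : ℝ × EuclideanSpace ℝ (Fin n) × EuclideanSpace ℝ (Fin n) |
          q.1 < g q.2.1 ∧ g q.2.2 ≤ q.1}).indicator (fun q => K (dist q.2.1 q.2.2)) (t, x, y)
      with hFdef
    have e1 : ∀ t, ∫⁻ x in {x | t < g x}, ∫⁻ y in {x | t < g x}ᶜ, K (dist x y)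
        = ∫⁻ x, ∫⁻ y, F t x y := by
      intro t
      rw [← lintegral_indicator (hA t)]
      congr 1; ext x
      by_cases hx : x ∈ {x | t < g x}
      · rw [indicator_of_mem hx, ← lintegral_indicator (hA t).compl]
        congr 1; ext y
        simp only [mem_ofPred_eq] at hx
        simp [hFdef, indicator, hx]
      · rw [indicator_of_notMem hx]
        simp only [mem_ofPred_eq] at hx
        simp [hFdef, indicator, hx]
    have e2 : ∀ x y, ∫⁻ t in Ioi (0:ℝ), F t x y = ENNReal.ofReal (g x - g y) * K (dist x y) := by
      intro x y
      have : (fun t => F t x y) = (Ico (g y) (g x)).indicator (fun _ => K (dist x y)) := by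
        ext t
        simp only [hFdef, indicator, mem_ofPred_eq, mem_Ico]
        congr 1
        simp [and_comm]
      rw [this, lintegral_indicator measurableSet_Ico, Measure.restrict_restrict measurableSet_Ico,
        setLIntegral_const, mul_comm]
      congr 1
      rw [← Real.volume_Ico]
      have h1 : (Ico (g y) (g x) ∩ Ioi 0 : Set ℝ) =ᵐ[volume] Ico (g y) (g x) := by
        have : (Ico (g y) (g x) ∩ Ici 0 : Set ℝ) = Ico (g y) (g x) :=
          inter_eq_left.2 fun t ht => (hg0 y).trans ht.1
        conv_rhs => rw [← this]
        exact (ae_eq_refl _).inter Ioi_ae_eq_Ici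
      exact measure_congr h1
    calc c * ∫⁻ t in Ioi (0:ℝ), φ (volume {x | t < g x})
        = ∫⁻ t in Ioi (0:ℝ), c * φ (volume {x | t < g x}) := by
          rw [lintegral_const_mul' _ _ hct]
      _ ≤ ∫⁻ t in Ioi (0:ℝ), ∫⁻ x, ∫⁻ y, F t x y := by
          refine setLIntegral_mono' measurableSet_Ioi fun t ht => ?_
          rw [← e1]
          exact osm_isop n hn φ K c hφ0 hK hKφ _ (hA t) (hfin t ht)
      _ = ∫⁻ x, ∫⁻ t in Ioi (0:ℝ), ∫⁻ y, F t x y := by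
          refine lintegral_lintegral_swap (Measurable.aemeasurable ?_)
          have : Measurable fun p : (ℝ × EuclideanSpace ℝ (Fin n)) × EuclideanSpace ℝ (Fin n) =>
              F p.1.1 p.1.2 p.2 := hF.comp (by fun_prop : Measurable fun p :
                (ℝ × EuclideanSpace ℝ (Fin n)) × EuclideanSpace ℝ (Fin n) => (p.1.1, p.1.2, p.2))
          exact this.lintegral_prod_right'
      _ = ∫⁻ x, ∫⁻ y, ∫⁻ t in Ioi (0:ℝ), F t x y := by
          congr 1; ext x
          refine lintegral_lintegral_swap (Measurable.aemeasurable ?_)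
          exact hF.comp (by fun_prop : Measurable fun p :
                ℝ × EuclideanSpace ℝ (Fin n) => (p.1, x, p.2))
      _ = _ := by simp_rw [e2]
  have hco1 : ∫⁻ t in Ioi (0:ℝ), φ (volume {x | t < g x}) ≤ 1 := by
    rw [← ENNReal.mul_le_mul_iff_right hc0 hct]; simpa using hco
  have hpt : ∀ t : ℝ, 0 < t → h t * volume {x | t < g x} ≤ φ (volume {x | t < g x}) := by
    intro t ht
    refine hhφ t _ ht (hfin t ht) (le_trans ?_ hco1)
    calc ENNReal.ofReal t * φ (volume {x | t < g x})
        = ∫⁻ s in Ioc 0 t, φ (volume {x | t < g x}) := by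
          rw [setLIntegral_const, Real.volume_Ioc, sub_zero, mul_comm]
      _ ≤ ∫⁻ s in Ioc 0 t, φ (volume {x | s < g x}) := by
          refine setLIntegral_mono' measurableSet_Ioc fun s hs => hφm (measure_mono ?_)
          intro x hx; exact lt_of_le_of_lt hs.2 hx
      _ ≤ _ := lintegral_mono_set fun s hs => hs.1
  set G : EuclideanSpace ℝ (Fin n) → ℝ → ℝ≥0∞ := fun x t =>
    ({q : EuclideanSpace ℝ (Fin n) × ℝ | q.2 < g q.1}).indicator (fun q => h q.2) (x, t) with hG
  have hNG : ∀ x, N (g x / 2).toNNReal ≤ ∫⁻ t in Ioi (0:ℝ), G x t := by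
    intro x
    rcases (hg0 x).eq_or_lt with h0 | h0
    · simp [← h0, hN0]
    refine (hNh _ (half_pos h0)).trans ?_
    calc ENNReal.ofReal (g x / 2) * h (g x / 2) = ∫⁻ t in Ico (g x / 2) (g x), h (g x / 2) := by
          rw [setLIntegral_const, Real.volume_Ico, mul_comm]; congr 2; ring
      _ ≤ ∫⁻ t in Ico (g x / 2) (g x), G x t := by
          refine setLIntegral_mono' measurableSet_Ico fun t ht => ?_
          simp only [hG, indicator, mem_ofPred_eq, ht.2, if_true]
          exact hh _ _ (half_pos h0).le ht.1
      _ ≤ _ := lintegral_mono_set fun t ht => lt_of_lt_of_le (half_pos h0) ht.1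
  calc ∫⁻ x, N (g x / 2).toNNReal ≤ ∫⁻ x, ∫⁻ t in Ioi (0:ℝ), G x t := lintegral_mono hNG
    _ = ∫⁻ t in Ioi (0:ℝ), ∫⁻ x, G x t := by
        refine lintegral_lintegral_swap (Measurable.aemeasurable ?_)
        exact (hhm.comp measurable_snd).indicator (measurableSet_lt (by fun_prop) (by fun_prop))
    _ = ∫⁻ t in Ioi (0:ℝ), h t * volume {x | t < g x} := by
        congr 1; ext t
        rw [← setLIntegral_const, ← lintegral_indicator (hA t)]
        rfl
    _ ≤ ∫⁻ t in Ioi (0:ℝ), φ (volume {x | t < g x}) :=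
        setLIntegral_mono' measurableSet_Ioi hpt
    _ ≤ 1 := hco1

lemma osm_norm (n : ℕ) (hn : 1 ≤ n) (N : ℝ≥0 → ℝ≥0∞) (h : ℝ → ℝ≥0∞)
    (φ : ℝ≥0∞ → ℝ≥0∞) (K : ℝ → ℝ≥0∞) (c : ℝ≥0∞) (hc0 : c ≠ 0) (hct : c ≠ ∞)
    (hφ0 : φ 0 = 0) (hφm : Monotone φ) (hKm : Measurable K)
    (hh : ∀ s t : ℝ, 0 ≤ s → s ≤ t → h s ≤ h t) (hhm : Measurable h)
    (hN0 : N 0 = 0) (hNmono : Monotone N) (hNpos : ∀ s, 0 < s → N s ≠ 0)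
    (hNh : ∀ s : ℝ, 0 < s → N s.toNNReal ≤ ENNReal.ofReal s * h s)
    (hhφ : ∀ (t : ℝ) (m : ℝ≥0∞), 0 < t → m ≠ ∞ → ENNReal.ofReal t * φ m ≤ 1 → h t * m ≤ φ m)
    (hK : ∀ r s : ℝ, 0 < r → r ≤ s → K s ≤ K r)
    (hKφ : ∀ (R : ℝ) (m : ℝ≥0∞), 0 < R → m ≠ 0 → m ≠ ∞ →
      volume (Metric.ball (0 : EuclideanSpace ℝ (Fin n)) R) = 2 * m → c * φ m ≤ m * (m * K R))
    (f : EuclideanSpace ℝ (Fin n) → ℝ) (hf : Measurable f)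
    (hfin : orliczNorm volume N f < ∞) :
    orliczNorm volume N f ≤ 2 / c * ∫⁻ x, ∫⁻ y, (‖f x - f y‖₊ : ℝ≥0∞) * K (dist x y) := by
  set D := ∫⁻ x, ∫⁻ y, (‖f x - f y‖₊ : ℝ≥0∞) * K (dist x y) with hDdef
  have hlev : ∀ t : ℝ, 0 < t → volume {x | t < |f x|} ≠ ∞ := by
    intro t ht
    simp only [orliczNorm, iInf_lt_iff] at hfin
    obtain ⟨r, ⟨hr0, hr⟩, -⟩ := hfin
    have hm : AEMeasurable (fun x => N (‖f x‖₊ / r)) volume :=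
      (hNmono.measurable.comp (by fun_prop)).aemeasurable
    have hp : 0 < t.toNNReal / r := div_pos (Real.toNNReal_pos.2 ht) hr0
    have h1 := mul_meas_ge_le_lintegral₀ hm (N (t.toNNReal / r))
    have h2 : {x | t < |f x|} ⊆ {x | N (t.toNNReal / r) ≤ N (‖f x‖₊ / r)} := by
      intro x hx
      refine hNmono ?_
      gcongr
      rw [Real.toNNReal_le_iff_le_coe]
      simpa using (le_of_lt hx)
    intro htop
    have h3 : volume {x | N (t.toNNReal / r) ≤ N (‖f x‖₊ / r)} = ∞ :=
      top_le_iff.1 (htop ▸ measure_mono h2)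
    rw [h3, ENNReal.mul_top (hNpos _ hp)] at h1
    exact absurd (h1.trans hr) (by simp)
  have key : ∀ r : ℝ≥0, D / c < r → orliczNorm volume N f ≤ 2 * r := by
    intro r hr
    have hr0 : 0 < r := by
      have := lt_of_le_of_lt (zero_le (a := D / c)) hr
      exact_mod_cast this
    have hrR : (0:ℝ) < r := hr0
    have hle : D ≤ r * c := by
      rw [ENNReal.div_lt_iff (Or.inl hc0) (Or.inl hct)] at hr
      exact hr.le
    have hc := osm_core n hn N h φ K c hc0 hct hφ0 hφm hKm hh hhm hN0 hNh hhφ hK hKφ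
      (fun x => |f x| / r) (by fun_prop) (fun x => by positivity)
      (by
        intro t ht
        have := hlev (t * r) (by positivity)
        simpa only [lt_div_iff₀ hrR] using this)
      (by
        calc ∫⁻ x, ∫⁻ y, ENNReal.ofReal (|f x| / r - |f y| / r) * K (dist x y)
            ≤ ∫⁻ x, ∫⁻ y, (r : ℝ≥0∞)⁻¹ * ((‖f x - f y‖₊ : ℝ≥0∞) * K (dist x y)) := by
              refine lintegral_mono fun x => lintegral_mono fun y => ?_
              rw [← mul_assoc]
              gcongr
              have : (r : ℝ≥0∞)⁻¹ * (‖f x - f y‖₊ : ℝ≥0∞)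
                  = ENNReal.ofReal ((r:ℝ)⁻¹ * |f x - f y|) := by
                rw [ENNReal.ofReal_mul (by positivity), ENNReal.ofReal_inv_of_pos hrR,
                  ENNReal.ofReal_coe_nnreal, ← Real.norm_eq_abs, ofReal_norm]
                rfl
              rw [this]
              apply ENNReal.ofReal_le_ofReal
              rw [← _root_.sub_div, div_eq_inv_mul]
              gcongr
              exact abs_sub_abs_le_abs_sub _ _
          _ = (r : ℝ≥0∞)⁻¹ * D := by
              have hri : (r : ℝ≥0∞)⁻¹ ≠ ∞ := by simp [hr0.ne']
              simp_rw [lintegral_const_mul' _ _ hri]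
              rfl
          _ ≤ (r : ℝ≥0∞)⁻¹ * (r * c) := by gcongr
          _ = c := by
              rw [← mul_assoc, ENNReal.inv_mul_cancel (by simp [hr0.ne']) (by simp), one_mul])
    have : orliczNorm volume N f ≤ ((2 * r : ℝ≥0) : ℝ≥0∞) := by
      refine iInf₂_le (2 * r) ⟨by positivity, ?_⟩
      refine le_trans (le_of_eq ?_) hc
      congr 1; ext x; congr 1
      ext
      rw [Real.coe_toNNReal _ (by positivity)]
      push_cast
      rw [Real.norm_eq_abs]
      field_simp
    simpa using this
  have h2 : 2 / c * D = 2 * (D / c) := by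
    rw [div_eq_mul_inv, div_eq_mul_inv]; ring
  rw [h2]
  have : orliczNorm volume N f / 2 ≤ D / c := by
    refine ENNReal.le_of_forall_pos_le_add ?_ |> fun h => h
    intro ε hε hlt
    have h3 := key ((D / c).toNNReal + ε) (by
      rw [ENNReal.coe_add, ENNReal.coe_toNNReal hlt.ne]
      exact ENNReal.lt_add_right hlt.ne (by simpa using hε.ne'))
    rw [ENNReal.coe_add, ENNReal.coe_toNNReal hlt.ne] at h3
    refine ENNReal.div_le_of_le_mul ?_
    rwa [mul_comm]
  rw [ENNReal.div_le_iff (by simp) (by simp)] at this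
  rwa [mul_comm]

lemma osm_pow (p : ℝ) (hp : 1 < p) (t : ℝ) (m u : ℝ≥0∞)
    (hu : ENNReal.ofReal t * u ≤ 1) (hm : m ≤ u ^ p) :
    ENNReal.ofReal t ^ (p - 1) * m ≤ u := by
  calc ENNReal.ofReal t ^ (p - 1) * m ≤ ENNReal.ofReal t ^ (p - 1) * (u ^ (p - 1) * u) := by
        gcongr
        refine hm.trans (le_of_eq ?_)
        have := ENNReal.rpow_add_of_nonneg (x := u) (p - 1) 1 (by linarith) zero_le_one
        rw [ENNReal.rpow_one] at this
        rw [← this]; congr 1; ring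
    _ = (ENNReal.ofReal t * u) ^ (p - 1) * u := by
        rw [ENNReal.mul_rpow_of_nonneg _ _ (by linarith), mul_assoc]
    _ ≤ 1 * u := by
        gcongr
        exact ENNReal.rpow_le_one hu (by linarith)
    _ = u := one_mul u

lemma osm_split (p : ℝ) (hp : 1 < p) (s : ℝ) :
    ((s.toNNReal : ℝ≥0∞)) ^ p = ENNReal.ofReal s * ENNReal.ofReal s ^ (p - 1) := by
  have := ENNReal.rpow_add_of_nonneg (x := ENNReal.ofReal s) 1 (p - 1) zero_le_one (by linarith)
  rw [ENNReal.rpow_one] at this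
  rw [← this]; congr 1; ring

/-- the exact isoperimetric quantity for a single power -/
lemma osm_ball (n : ℕ) (hn : 1 ≤ n) (a : ℝ) (ha : 0 < a) (hna : 0 < (n : ℝ) - a) :
    ∃ c : ℝ≥0∞, c ≠ 0 ∧ c ≠ ∞ ∧ ∀ (R : ℝ) (m : ℝ≥0∞), 0 < R → m ≠ 0 → m ≠ ∞ →
      volume (Metric.ball (0 : EuclideanSpace ℝ (Fin n)) R) = 2 * m →
      c * m ^ ((n : ℝ) / (n - a))⁻¹ ≤ m * (m * ENNReal.ofReal (1 / R ^ ((n : ℝ) + a))) := by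
  have : Nonempty (Fin n) := ⟨⟨0, hn⟩⟩
  obtain ⟨w, hw⟩ : ∃ w : ℝ, w = (volume (Metric.ball (0 : EuclideanSpace ℝ (Fin n)) 1)).toReal :=
    ⟨_, rfl⟩
  have hwt : volume (Metric.ball (0 : EuclideanSpace ℝ (Fin n)) 1) ≠ ∞ := measure_ball_lt_top.ne
  have hw0 : 0 < w := by
    rw [hw]; exact ENNReal.toReal_pos (Metric.measure_ball_pos _ _ one_pos).ne' hwt
  have hn0 : (0:ℝ) < n := by exact_mod_cast hn
  refine ⟨ENNReal.ofReal ((w / 2) ^ (1 + a / n)), ?_, by simp, ?_⟩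
  · simp only [ne_eq, ENNReal.ofReal_eq_zero, not_le]; positivity
  intro R m hR hm0 hmt hv
  lift m to ℝ≥0 using hmt
  have hm : (0:ℝ) < m := by
    have : m ≠ 0 := by exact_mod_cast hm0
    exact_mod_cast pos_iff_ne_zero.2 this
  rw [Measure.addHaar_ball_of_pos _ _ hR, finrank_euclideanSpace_fin] at hv
  have hv' : R ^ n * w = 2 * m := by
    have := congrArg ENNReal.toReal hv
    rw [ENNReal.toReal_mul, ← hw, ENNReal.toReal_ofReal (by positivity)] at this
    simpa using this
  have hRn : (m : ℝ) = (w / 2) * R ^ (n : ℝ) := by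
    rw [Real.rpow_natCast]; linarith
  rw [← ENNReal.ofReal_coe_nnreal, ENNReal.ofReal_rpow_of_pos hm,
    ← ENNReal.ofReal_mul (by positivity), ← ENNReal.ofReal_mul (by positivity),
    ← ENNReal.ofReal_mul (by positivity)]
  apply ENNReal.ofReal_le_ofReal
  apply le_of_eq
  have hth : ((n : ℝ) / (n - a))⁻¹ = 2 - (1 + a / n) := by field_simp; ring
  have hRa : R ^ ((n:ℝ) + a) = (R ^ (n:ℝ)) ^ (1 + a / n) := by
    rw [← Real.rpow_mul hR.le]; congr 1; field_simp
  have hmR : (m : ℝ) ^ (1 + a / n) = (w / 2) ^ (1 + a / n) * R ^ ((n:ℝ) + a) := by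
    rw [hRa, ← Real.mul_rpow (by positivity) (by positivity), ← hRn]
  rw [hth, Real.rpow_sub hm, hmR, Real.rpow_two]
  have : 0 < R ^ ((n:ℝ) + a) := by positivity
  have : 0 < (w / 2) ^ (1 + a / n) := by positivity
  field_simp

/-- the sharp Orlicz–Sobolev type isoperimetric inequalities for
the mixed stable kernels, with Young functions `N^∧` and `N^∨`. -/
theorem orliczSobolev_mixed_stable
    (n : ℕ) (hn : 1 ≤ n) (α₁ α₂ : ℝ)
    (hα₁ : α₁ ∈ Ioo (0 : ℝ) 2) (hα₂ : α₂ ∈ Ioo (0 : ℝ) 2) :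
    ∃ C : ℝ, 0 < C ∧
      (∀ f : EuclideanSpace ℝ (Fin n) → ℝ, Measurable f →
        orliczNorm volume (Nand n α₁ α₂) f < ∞ →
        orliczNorm volume (Nand n α₁ α₂) f ≤ ENNReal.ofReal C *
          ∫⁻ x, (∫⁻ y, (‖f x - f y‖₊ : ℝ≥0∞) *
            ENNReal.ofReal (1 / max (dist x y ^ ((n : ℝ) + α₁ / 2))
              (dist x y ^ ((n : ℝ) + α₂ / 2))))) ∧
      (∀ f : EuclideanSpace ℝ (Fin n) → ℝ, Measurable f →
        orliczNorm volume (Nor n α₁ α₂) f < ∞ →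
        orliczNorm volume (Nor n α₁ α₂) f ≤ ENNReal.ofReal C *
          ∫⁻ x, (∫⁻ y, (‖f x - f y‖₊ : ℝ≥0∞) *
            ENNReal.ofReal (1 / min (dist x y ^ ((n : ℝ) + α₁ / 2))
              (dist x y ^ ((n : ℝ) + α₂ / 2))))) := by
  have hn0 : (1:ℝ) ≤ n := by exact_mod_cast hn
  obtain ⟨hα₁0, hα₁2⟩ := hα₁
  obtain ⟨hα₂0, hα₂2⟩ := hα₂
  obtain ⟨c₁, hc₁0, hc₁t, hc₁⟩ := osm_ball n hn (α₁ / 2) (by linarith) (by linarith)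
  obtain ⟨c₂, hc₂0, hc₂t, hc₂⟩ := osm_ball n hn (α₂ / 2) (by linarith) (by linarith)
  have hp₁ : 1 < (n:ℝ) / (n - α₁ / 2) := by
    rw [one_lt_div (by linarith)]; linarith
  have hp₂ : 1 < (n:ℝ) / (n - α₂ / 2) := by
    rw [one_lt_div (by linarith)]; linarith
  unfold Nand Nor
  set p₁ := (n:ℝ) / (n - α₁ / 2) with hp₁d
  set p₂ := (n:ℝ) / (n - α₂ / 2) with hp₂d
  have hp₁0 : 0 < p₁ := by linarith
  have hp₂0 : 0 < p₂ := by linarith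
  set e₁ := (n:ℝ) + α₁ / 2 with he₁
  set e₂ := (n:ℝ) + α₂ / 2 with he₂
  have he₁0 : 0 < e₁ := by linarith
  have he₂0 : 0 < e₂ := by linarith
  set c := min c₁ c₂ with hc
  have hc0 : c ≠ 0 := by
    rcases min_choice c₁ c₂ with h | h <;> rw [hc, h] <;> assumption
  have hct : c ≠ ∞ := ne_top_of_le_ne_top hc₁t (min_le_left _ _)
  have hcc₁ : c ≤ c₁ := min_le_left _ _
  have hcc₂ : c ≤ c₂ := min_le_right _ _
  have h2t : 2 / c ≠ ∞ := ENNReal.div_ne_top (by simp) hc0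
  have h20 : 2 / c ≠ 0 := by simp [hct]
  refine ⟨(2 / c).toReal, ENNReal.toReal_pos h20 h2t, ?_, ?_⟩
  · intro f hf hfin
    rw [ENNReal.ofReal_toReal h2t]
    refine osm_norm n hn _ (fun t => min (ENNReal.ofReal t ^ (p₁ - 1)) (ENNReal.ofReal t ^ (p₂ - 1)))
      (fun m => min (m ^ p₁⁻¹) (m ^ p₂⁻¹))
      (fun r => ENNReal.ofReal (1 / max (r ^ e₁) (r ^ e₂))) c hc0 hct ?_ ?_ ?_ ?_ ?_ ?_ ?_ ?_ ?_ ?_ ?_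
      ?_ f hf hfin
    · simp [hp₁0, hp₂0]
    · intro x y hxy
      exact min_le_min (ENNReal.rpow_le_rpow hxy (by positivity))
        (ENNReal.rpow_le_rpow hxy (by positivity))
    · fun_prop
    · intro s t _ hst
      exact min_le_min (ENNReal.rpow_le_rpow (ENNReal.ofReal_le_ofReal hst) (by linarith))
        (ENNReal.rpow_le_rpow (ENNReal.ofReal_le_ofReal hst) (by linarith))
    · fun_prop
    · simp [hp₁0, hp₂0]
    · intro x y hxy
      have hxy' : (x : ℝ≥0∞) ≤ y := by exact_mod_cast hxy
      exact min_le_min (ENNReal.rpow_le_rpow hxy' hp₁0.le) (ENNReal.rpow_le_rpow hxy' hp₂0.le)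
    · intro s hs
      have h1 : ∀ p : ℝ, (s : ℝ≥0∞) ^ p ≠ 0 := fun p =>
        (ENNReal.rpow_pos (by exact_mod_cast hs) (by simp)).ne'
      rcases min_choice ((s : ℝ≥0∞) ^ p₁) ((s : ℝ≥0∞) ^ p₂) with h | h <;> simp only [h] <;>
        exact h1 _
    · intro s _
      simp only [osm_split _ hp₁, osm_split _ hp₂]
      rcases min_choice (ENNReal.ofReal s ^ (p₁ - 1)) (ENNReal.ofReal s ^ (p₂ - 1)) with h | h <;>
        rw [h]
      · exact min_le_left _ _
      · exact min_le_right _ _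
    · intro t m _ _ hu
      rcases min_choice (m ^ p₁⁻¹) (m ^ p₂⁻¹) with h | h <;> simp only [h] at hu ⊢
      · refine le_trans ?_ (osm_pow p₁ hp₁ t m _ hu (by rw [ENNReal.rpow_inv_rpow hp₁0.ne']))
        gcongr; exact min_le_left _ _
      · refine le_trans ?_ (osm_pow p₂ hp₂ t m _ hu (by rw [ENNReal.rpow_inv_rpow hp₂0.ne']))
        gcongr; exact min_le_right _ _
    · intro r s hr hrs
      have : 0 < max (r ^ e₁) (r ^ e₂) := lt_max_of_lt_left (by positivity)
      gcongr
    · intro R m hR hm0 hmt hv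
      rcases max_choice (R ^ e₁) (R ^ e₂) with h | h <;> simp only [h]
      · exact le_trans (mul_le_mul' hcc₁ (min_le_left _ _)) (hc₁ R m hR hm0 hmt hv)
      · exact le_trans (mul_le_mul' hcc₂ (min_le_right _ _)) (hc₂ R m hR hm0 hmt hv)
  · intro f hf hfin
    rw [ENNReal.ofReal_toReal h2t]
    refine osm_norm n hn _ (fun t => max (ENNReal.ofReal t ^ (p₁ - 1)) (ENNReal.ofReal t ^ (p₂ - 1)))
      (fun m => max (m ^ p₁⁻¹) (m ^ p₂⁻¹))
      (fun r => ENNReal.ofReal (1 / min (r ^ e₁) (r ^ e₂))) c hc0 hct ?_ ?_ ?_ ?_ ?_ ?_ ?_ ?_ ?_ ?_ ?_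
      ?_ f hf hfin
    · simp [hp₁0, hp₂0]
    · intro x y hxy
      exact max_le_max (ENNReal.rpow_le_rpow hxy (by positivity))
        (ENNReal.rpow_le_rpow hxy (by positivity))
    · fun_prop
    · intro s t _ hst
      exact max_le_max (ENNReal.rpow_le_rpow (ENNReal.ofReal_le_ofReal hst) (by linarith))
        (ENNReal.rpow_le_rpow (ENNReal.ofReal_le_ofReal hst) (by linarith))
    · fun_prop
    · simp [hp₁0, hp₂0]
    · intro x y hxy
      have hxy' : (x : ℝ≥0∞) ≤ y := by exact_mod_cast hxy
      exact max_le_max (ENNReal.rpow_le_rpow hxy' hp₁0.le) (ENNReal.rpow_le_rpow hxy' hp₂0.le)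
    · intro s hs
      have h1 : ∀ p : ℝ, (s : ℝ≥0∞) ^ p ≠ 0 := fun p =>
        (ENNReal.rpow_pos (by exact_mod_cast hs) (by simp)).ne'
      rcases max_choice ((s : ℝ≥0∞) ^ p₁) ((s : ℝ≥0∞) ^ p₂) with h | h <;> simp only [h] <;>
        exact h1 _
    · intro s _
      simp only [osm_split _ hp₁, osm_split _ hp₂]
      refine max_le ?_ ?_ <;> gcongr
      · exact le_max_left _ _
      · exact le_max_right _ _
    · intro t m _ _ hu
      rcases max_choice (ENNReal.ofReal t ^ (p₁ - 1)) (ENNReal.ofReal t ^ (p₂ - 1)) with h | h <;>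
        rw [h]
      · refine osm_pow p₁ hp₁ t m _ hu ?_
        calc m = (m ^ p₁⁻¹) ^ p₁ := by rw [ENNReal.rpow_inv_rpow hp₁0.ne']
          _ ≤ _ := ENNReal.rpow_le_rpow (le_max_left _ _) hp₁0.le
      · refine osm_pow p₂ hp₂ t m _ hu ?_
        calc m = (m ^ p₂⁻¹) ^ p₂ := by rw [ENNReal.rpow_inv_rpow hp₂0.ne']
          _ ≤ _ := ENNReal.rpow_le_rpow (le_max_right _ _) hp₂0.le
    · intro r s hr hrs
      have : 0 < min (r ^ e₁) (r ^ e₂) := lt_min (by positivity) (by positivity)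
      gcongr
    · intro R m hR hm0 hmt hv
      have hpos : 0 < min (R ^ e₁) (R ^ e₂) := lt_min (by positivity) (by positivity)
      rcases max_choice (m ^ p₁⁻¹) (m ^ p₂⁻¹) with h | h <;> simp only [h]
      · refine le_trans (mul_le_mul' hcc₁ le_rfl) ((hc₁ R m hR hm0 hmt hv).trans ?_)
        gcongr; exact min_le_left _ _
      · refine le_trans (mul_le_mul' hcc₂ le_rfl) ((hc₂ R m hR hm0 hmt hv).trans ?_)
        gcongr; exact min_le_right _ _
end
end

section
/- Let α ∈ (0,2) and q, p ∈ ℝ, and let λ ≥ 2 be large enough that both N_α^{log,q,+}(s) := ( s log^q(λ + s) )^{n/(n−α/2)} and N_α^{log,p,−}(s) := ( s log^p(λ + s^{-1}) )^{n/(n−α/2)} are Young functions. Then there exists a constant C > 0 such that ‖f‖_{N_α^{log,q,+}} ≤ C ∫_{ℝⁿ×ℝⁿ} |f(x) − f(y)| · { log(2 + |x−y|^{-1}) }^q / |x−y|^{n+α/2} dx dy for all f ∈ L_{N_α^{log,q,+}}(ℝⁿ), and ‖f‖_{N_α^{log,p,−}} ≤ C ∫_{ℝⁿ×ℝⁿ}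 |f(x) − f(y)| · { log(2 + |x−y|) }^p / |x−y|^{n+α/2} dx dy for all f ∈ L_{N_α^{log,p,−}}(ℝⁿ). -/
open MeasureTheory ENNReal NNReal Filter Set

noncomputable section

lemma YoungFunction.subgrad (N : YoungFunction) (hfin : ∀ s, N.toFun s ≠ ∞) (s₀ : ℝ≥0) :
    ∃ a d : ℝ≥0, (∀ s : ℝ≥0, (a : ℝ≥0∞) * s ≤ N.toFun s + d) ∧
      (a : ℝ≥0∞) * s₀ = N.toFun s₀ + d := by
  rcases eq_or_ne s₀ 0 with rfl | hs
  · exact ⟨0, 0, by simp, by simp [N.map_zero]⟩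
  have hs0 : 0 < (s₀ : ℝ) := by exact_mod_cast pos_iff_ne_zero.mpr hs
  set φ : ℝ → ℝ := fun x => (N.toFun x.toNNReal).toReal with hφ
  have hφs : ∀ s : ℝ≥0, N.toFun s = ENNReal.ofReal (φ s) := by
    intro s
    simp only [hφ, Real.toNNReal_coe]
    rw [ENNReal.ofReal_toReal (hfin s)]
  have hφ0 : φ 0 = 0 := by simp [hφ, N.map_zero]
  have hφnn : ∀ x, 0 ≤ φ x := fun x => ENNReal.toReal_nonneg
  have hconv : ConvexOn ℝ (Ici 0) φ := by
    refine ⟨convex_Ici 0, ?_⟩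
    intro x hx y hy a b ha hb hab
    lift x to ℝ≥0 using hx
    lift y to ℝ≥0 using hy
    lift a to ℝ≥0 using ha
    lift b to ℝ≥0 using hb
    have hab' : a + b = 1 := by exact_mod_cast hab
    have ha1 : a ≤ 1 := by rw [← hab']; exact le_self_add
    have hb' : 1 - a = b := by rw [← hab']; simp
    have h := N.convex x y a ha1
    rw [hb', hφs, hφs, hφs] at h
    have h2 : ENNReal.ofReal (φ (a * x + b * y)) ≤ ENNReal.ofReal (a * φ x + b * φ y) := by
      rw [ENNReal.ofReal_add (by have := hφnn x; positivity) (by have := hφnn y; positivity),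
        ENNReal.ofReal_mul (by positivity), ENNReal.ofReal_mul (by positivity)]
      simpa using h
    simp only [smul_eq_mul]
    exact (ENNReal.ofReal_le_ofReal_iff (by have := hφnn x; have := hφnn y; positivity)).1 h2
  have hmemint : (s₀ : ℝ) ∈ interior (Ici (0:ℝ)) := by simpa using hs0
  set b := derivWithin φ (Ioi (s₀:ℝ)) s₀ with hb
  have hsub : ∀ x : ℝ, 0 ≤ x → φ s₀ + b * (x - s₀) ≤ φ x := by
    intro x hx
    rcases lt_trichotomy x s₀ with h | h | h
    · have h1 := hconv.slope_le_leftDeriv_of_mem_interior (mem_Ici.2 hx) hmemint h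
      have h2 := hconv.leftDeriv_le_rightDeriv_of_mem_interior hmemint
      have h3 := h1.trans h2
      rw [slope_def_field, div_le_iff₀ (by linarith)] at h3
      linarith
    · subst h; simp
    · have h1 := hconv.rightDeriv_le_slope_of_mem_interior hmemint (mem_Ici.2 hx) h
      rw [slope_def_field, le_div_iff₀ (by linarith)] at h1
      linarith
  have hd : 0 ≤ b * s₀ - φ s₀ := by
    have := hsub 0 le_rfl
    rw [hφ0] at this; linarith
  have hbnn : 0 ≤ b := by
    have := hφnn s₀
    by_contra hneg
    push Not at hneg
    nlinarith
  refine ⟨b.toNNReal, (b * s₀ - φ s₀).toNNReal, ?_, ?_⟩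
  · intro s
    have h := hsub s s.2
    rw [hφs]
    change ENNReal.ofReal b * _ ≤ _ + ENNReal.ofReal _
    rw [← ENNReal.ofReal_add (hφnn _) hd, ← ENNReal.ofReal_coe_nnreal (p := s),
      ← ENNReal.ofReal_mul hbnn]
    apply ENNReal.ofReal_le_ofReal
    linarith
  · rw [hφs]
    change ENNReal.ofReal b * _ = _ + ENNReal.ofReal _
    rw [← ENNReal.ofReal_add (hφnn _) hd]
    nth_rewrite 1 [← ENNReal.ofReal_coe_nnreal (p := s₀)]
    rw [← ENNReal.ofReal_mul hbnn]
    congr 1; ring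

lemma YoungFunction.scale (N : YoungFunction) (e s : ℝ≥0) (he : e ≤ 1) :
    N.toFun (e * s) ≤ e * N.toFun s := by
  have := N.convex s 0 e he
  simpa [N.map_zero] using this

/-- one-sided level set interaction kernel -/
def levG {E : Type*} (K : E → E → ℝ≥0∞) (f : E → ℝ) (t : ℝ) (x y : E) : ℝ≥0∞ :=
  if t < |f x| ∧ |f y| ≤ t then K x y else 0

def levP {E : Type*} [MeasurableSpace E] (μ : Measure E) (K : E → E → ℝ≥0∞) (f : E → ℝ)
    (t : ℝ) : ℝ≥0∞ := ∫⁻ x, ∫⁻ y, levG K f t x y ∂μ ∂μ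

lemma measurable_levG {E : Type*} [MeasurableSpace E] {K : E → E → ℝ≥0∞}
    (hK : Measurable (Function.uncurry K)) {f : E → ℝ} (hf : Measurable f) :
    Measurable (fun z : ℝ × E × E => levG K f z.1 z.2.1 z.2.2) := by
  unfold levG
  refine Measurable.ite ?_ (hK.comp measurable_snd) measurable_const
  refine MeasurableSet.inter (measurableSet_lt measurable_fst ?_) (measurableSet_le ?_ measurable_fst)
  · exact (hf.comp (measurable_fst.comp measurable_snd)).abs
  · exact (hf.comp (measurable_snd.comp measurable_snd)).abs

lemma measurable_levP {E : Type*} [MeasurableSpace E] {μ : Measure E} [SFinite μ]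
    {K : E → E → ℝ≥0∞}
    (hK : Measurable (Function.uncurry K)) {f : E → ℝ} (hf : Measurable f) :
    Measurable (levP μ K f) := by
  have h := measurable_levG hK hf
  have h1 : Measurable (fun z : ℝ × E => ∫⁻ y, levG K f z.1 z.2 y ∂μ) := by
    apply Measurable.lintegral_prod_right' (f := fun w : (ℝ × E) × E => levG K f w.1.1 w.1.2 w.2)
    exact h.comp (by fun_prop : Measurable (fun w : (ℝ × E) × E => (w.1.1, w.1.2, w.2)))
  exact Measurable.lintegral_prod_right' h1

lemma coarea_le {E : Type*} [MeasurableSpace E] {μ : Measure E} [SFinite μ]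
    {K : E → E → ℝ≥0∞}
    (hK : Measurable (Function.uncurry K)) {f : E → ℝ} (hf : Measurable f) :
    ∫⁻ t in Ioi (0:ℝ), levP μ K f t ≤ ∫⁻ x, ∫⁻ y, (‖f x - f y‖₊ : ℝ≥0∞) * K x y ∂μ ∂μ := by
  have h := measurable_levG hK hf
  have h1 : Measurable (fun z : ℝ × E => ∫⁻ y, levG K f z.1 z.2 y ∂μ) := by
    apply Measurable.lintegral_prod_right' (f := fun w : (ℝ × E) × E => levG K f w.1.1 w.1.2 w.2)
    exact h.comp (by fun_prop : Measurable (fun w : (ℝ × E) × E => (w.1.1, w.1.2, w.2)))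
  unfold levP
  rw [lintegral_lintegral_swap h1.aemeasurable]
  refine lintegral_mono fun x => ?_
  have h2 : Measurable (fun z : ℝ × E => levG K f z.1 x z.2) :=
    h.comp (by fun_prop : Measurable (fun z : ℝ × E => (z.1, x, z.2)))
  rw [lintegral_lintegral_swap h2.aemeasurable]
  refine lintegral_mono fun y => ?_
  calc ∫⁻ t in Ioi (0:ℝ), levG K f t x y
      ≤ ∫⁻ t, levG K f t x y := setLIntegral_le_lintegral _ _
    _ = ∫⁻ t, (Ico |f y| |f x|).indicator (fun _ => K x y) t := by
        refine lintegral_congr fun t => ?_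
        simp only [levG, indicator, mem_Ico, and_comm]
    _ = K x y * volume (Ico |f y| |f x|) := by
        rw [lintegral_indicator_const measurableSet_Ico]
    _ ≤ (‖f x - f y‖₊ : ℝ≥0∞) * K x y := by
        rw [mul_comm, Real.volume_Ico]
        gcongr
        rw [← enorm_eq_nnnorm, ← ofReal_norm]
        apply ENNReal.ofReal_le_ofReal
        exact abs_sub_abs_le_abs_sub _ _

lemma orlicz_le_of_iso {E : Type*} [MeasurableSpace E] {μ : Measure E} [SFinite μ]
    {K : E → E → ℝ≥0∞} (hK : Measurable (Function.uncurry K)) {f : E → ℝ} (hf : Measurable f)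
    (N : YoungFunction) (hfin : ∀ s, N.toFun s ≠ ∞) (C : ℝ≥0) (hC : 0 < C)
    (hiso : ∀ t : ℝ, 0 < t → μ {x | t < |f x|} ≠ 0 →
      levP μ K f t ≠ 0 ∧ (levP μ K f t ≠ ∞ →
        μ {x | t < |f x|} * N.toFun ((C * (levP μ K f t).toNNReal)⁻¹) ≤ 1)) :
    orliczNorm μ N.toFun f ≤ C *
      ∫⁻ x, ∫⁻ y, (‖f x - f y‖₊ : ℝ≥0∞) * K x y ∂μ ∂μ := by
  have hPm : Measurable (levP μ K f) := measurable_levP hK hf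
  have hNm : Measurable N.toFun := N.mono.measurable
  refine le_trans ?_ (mul_le_mul_right (coarea_le hK hf) _)
  set J := ∫⁻ t in Ioi (0:ℝ), levP μ K f t with hJ
  -- it suffices to treat positive finite upper bounds of the energy
  suffices H : ∀ J' : ℝ≥0, 0 < J' → J ≤ J' → orliczNorm μ N.toFun f ≤ C * J' by
    rcases eq_or_ne J ∞ with hJt | hJt
    · rw [hJt, ENNReal.mul_top (by exact_mod_cast hC.ne')]; exact le_top
    · refine ENNReal.le_of_forall_pos_le_add ?_
      intro ε hε _
      have hpos : 0 < ε / C := div_pos hε hC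
      have := H (J.toNNReal + ε / C) (by positivity) (by
        rw [ENNReal.coe_add, ENNReal.coe_toNNReal hJt]; exact le_self_add)
      refine this.trans (le_of_eq ?_)
      rw [ENNReal.coe_add, ENNReal.coe_toNNReal hJt, mul_add, ← ENNReal.coe_mul,
        mul_div_cancel₀ _ hC.ne']
  intro J' hJ' hJJ'
  have hCJ : 0 < C * J' := mul_pos hC hJ'
  have hJfin : J ≠ ∞ := ne_top_of_le_ne_top ENNReal.coe_ne_top hJJ'
  have hgoal : ∫⁻ x, N.toFun (‖f x‖₊ / (C * J')) ∂μ ≤ 1 := by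
    set Φ : ℝ → ℝ≥0∞ := fun t => levP μ K f t * N.toFun ((C * (levP μ K f t).toNNReal)⁻¹) with hΦ
    have hΦm : Measurable Φ :=
      hPm.mul (hNm.comp ((measurable_const.mul hPm.ennreal_toNNReal).inv))
    have hPfin : ∀ᵐ t ∂(volume.restrict (Ioi (0:ℝ))), levP μ K f t < ∞ :=
      ae_lt_top hPm hJfin
    have hae : ∀ᵐ x ∂μ, ∀ t : ℝ, t < |f x| → μ {x | t < |f x|} ≠ 0 := by
      have h0 : ∀ᵐ x ∂μ, ∀ r : ℚ, μ {x | (r:ℝ) < |f x|} = 0 → ¬ (r:ℝ) < |f x| := by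
        rw [ae_all_iff]
        intro r
        by_cases h : μ {x | (r:ℝ) < |f x|} = 0
        · have : ∀ᵐ x ∂μ, ¬ (r:ℝ) < |f x| := by
            rw [ae_iff]; simpa using h
          filter_upwards [this] with x hx _ using hx
        · exact Eventually.of_forall fun x h' => absurd h' h
      filter_upwards [h0] with x hx t ht hμ
      obtain ⟨r, hr1, hr2⟩ := exists_rat_btwn ht
      refine hx r (measure_mono_null ?_ hμ) hr2
      intro z hz
      exact hr1.trans hz
    have hpt : ∀ᵐ x ∂μ, N.toFun (‖f x‖₊ / (C * J')) * J' ≤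
        ∫⁻ t in Ioi (0:ℝ), {z : ℝ × E | z.1 < |f z.2|}.indicator (fun z => Φ z.1) (t, x) := by
      filter_upwards [hae] with x hx
      obtain ⟨a, d, had, heq⟩ := N.subgrad hfin (‖f x‖₊ / (C * J'))
      have key : (a : ℝ≥0∞) * (C⁻¹ : ℝ≥0) * ‖f x‖₊ ≤
          (∫⁻ t in Ioi (0:ℝ), {z : ℝ × E | z.1 < |f z.2|}.indicator (fun z => Φ z.1) (t, x))
            + d * J' := by
        calc (a : ℝ≥0∞) * (C⁻¹ : ℝ≥0) * ‖f x‖₊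
            = ∫⁻ t in Ioi (0:ℝ), (Iio |f x|).indicator (fun _ => (a : ℝ≥0∞) * (C⁻¹ : ℝ≥0)) t := by
              rw [lintegral_indicator_const measurableSet_Iio,
                Measure.restrict_apply measurableSet_Iio, Iio_inter_Ioi, Real.volume_Ioo, sub_zero,
                ← Real.norm_eq_abs, ofReal_norm, enorm_eq_nnnorm]
          _ ≤ ∫⁻ t in Ioi (0:ℝ), ({z : ℝ × E | z.1 < |f z.2|}.indicator (fun z => Φ z.1) (t, x)
                + d * levP μ K f t) := by
              refine lintegral_mono_ae ?_
              filter_upwards [hPfin, ae_restrict_mem measurableSet_Ioi] with t ht ht0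
              by_cases htx : t < |f x|
              · have h1 := (hiso t ht0 (hx t htx)).1
                simp only [indicator, mem_Iio, mem_ofPred_eq, htx, if_true, hΦ]
                generalize levP μ K f t = P at *
                lift P to ℝ≥0 using ht.ne
                have hP : P ≠ 0 := by exact_mod_cast h1
                have h2 := had ((C * P)⁻¹)
                calc (a : ℝ≥0∞) * (C⁻¹ : ℝ≥0) = P * (a * ((C * P)⁻¹ : ℝ≥0)) := by
                      norm_cast
                      field_simp
                  _ ≤ P * (N.toFun ((C * P)⁻¹) + d) := by gcongr
                  _ = _ := by simp only [ENNReal.toNNReal_coe]; ring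
              · simp [indicator, htx]
          _ = (∫⁻ t in Ioi (0:ℝ), {z : ℝ × E | z.1 < |f z.2|}.indicator (fun z => Φ z.1) (t, x))
                + d * J := by
              rw [lintegral_add_right _ (hPm.const_mul _), lintegral_const_mul _ hPm]
          _ ≤ _ := by gcongr
      have hL : (a : ℝ≥0∞) * (C⁻¹ : ℝ≥0) * ‖f x‖₊ =
          N.toFun (‖f x‖₊ / (C * J')) * J' + d * J' := by
        rw [← add_mul, ← heq]
        norm_cast
        field_simp
      rw [hL] at key
      exact (ENNReal.add_le_add_iff_right (by finiteness)).1 key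
    have hfin2 : (∫⁻ x, N.toFun (‖f x‖₊ / (C * J')) ∂μ) * J' ≤ J' := by
      have hS : MeasurableSet {z : ℝ × E | z.1 < |f z.2|} :=
        measurableSet_lt measurable_fst (hf.comp measurable_snd).abs
      calc (∫⁻ x, N.toFun (‖f x‖₊ / (C * J')) ∂μ) * J'
          = ∫⁻ x, N.toFun (‖f x‖₊ / (C * J')) * J' ∂μ :=
            (lintegral_mul_const' _ _ ENNReal.coe_ne_top).symm
        _ ≤ ∫⁻ x, (∫⁻ t in Ioi (0:ℝ),
              {z : ℝ × E | z.1 < |f z.2|}.indicator (fun z => Φ z.1) (t, x)) ∂μ :=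
            lintegral_mono_ae hpt
        _ = ∫⁻ t in Ioi (0:ℝ), ∫⁻ x,
              {z : ℝ × E | z.1 < |f z.2|}.indicator (fun z => Φ z.1) (t, x) ∂μ := by
            refine (lintegral_lintegral_swap ?_).symm
            exact ((hΦm.comp measurable_fst).indicator hS).aemeasurable
        _ ≤ ∫⁻ t in Ioi (0:ℝ), levP μ K f t := by
            refine lintegral_mono_ae ?_
            filter_upwards [hPfin, ae_restrict_mem measurableSet_Ioi] with t ht ht0
            have : ∫⁻ x, {z : ℝ × E | z.1 < |f z.2|}.indicator (fun z => Φ z.1) (t, x) ∂μ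
                = Φ t * μ {x | t < |f x|} := by
              rw [← lintegral_indicator_const (measurableSet_lt measurable_const hf.abs)]
              rfl
            rw [this]
            by_cases h0 : μ {x | t < |f x|} = 0
            · simp [h0]
            · have := (hiso t ht0 h0).2 ht.ne
              calc Φ t * μ {x | t < |f x|} = levP μ K f t *
                    (μ {x | t < |f x|} * N.toFun ((C * (levP μ K f t).toNNReal)⁻¹)) := by
                    simp only [hΦ]; ring
                _ ≤ levP μ K f t * 1 := by gcongr
                _ = _ := mul_one _
        _ ≤ J' := hJJ'
    have hJ0 : (J' : ℝ≥0∞) ≠ 0 := by exact_mod_cast hJ'.ne'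
    have := (ENNReal.mul_le_mul_iff_left hJ0 ENNReal.coe_ne_top).1 (hfin2.trans_eq (one_mul _).symm)
    exact this
  unfold orliczNorm
  refine (iInf₂_le (C * J') ⟨hCJ, hgoal⟩).trans ?_
  rw [ENNReal.coe_mul]

lemma iso_ineq (n : ℕ) (hn : 1 ≤ n) (Kr : ℝ → ℝ≥0∞) (N : YoungFunction) (c D : ℝ)
    (hc : 0 < c) (hD : 0 < D)
    (hKN : ∀ R : ℝ, 0 < R → ∃ k : ℝ, 0 < k ∧
      (∀ r : ℝ, 0 < r → r ≤ R → ENNReal.ofReal k ≤ Kr r) ∧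
      N.toFun (c / (R ^ (2 * n) * k)).toNNReal ≤ ENNReal.ofReal (D / R ^ n)) :
    ∃ C : ℝ≥0, 0 < C ∧ ∀ f : EuclideanSpace ℝ (Fin n) → ℝ, Measurable f → ∀ t : ℝ,
      volume {x | t < |f x|} ≠ 0 → volume {x | t < |f x|} ≠ ∞ →
      levP volume (fun x y => Kr (dist x y)) f t ≠ 0 ∧
      (levP volume (fun x y => Kr (dist x y)) f t ≠ ∞ →
        volume {x | t < |f x|} *
          N.toFun ((C * (levP volume (fun x y => Kr (dist x y)) f t).toNNReal)⁻¹) ≤ 1) := by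
  have : Nonempty (Fin n) := ⟨⟨0, hn⟩⟩
  have : Nontrivial (EuclideanSpace ℝ (Fin n)) := by
    apply Module.nontrivial_of_finrank_pos (R := ℝ); simp; omega
  set ω : ℝ := (volume (Metric.ball (0 : EuclideanSpace ℝ (Fin n)) 1)).toReal with hω
  have hωtop : volume (Metric.ball (0 : EuclideanSpace ℝ (Fin n)) 1) ≠ ∞ := measure_ball_lt_top.ne
  have hωpos : 0 < ω :=
    ENNReal.toReal_pos (Metric.measure_ball_pos volume _ one_pos).ne' hωtop
  have hball : ∀ (x : EuclideanSpace ℝ (Fin n)) (r : ℝ), 0 ≤ r →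
      volume (Metric.ball x r) = ENNReal.ofReal (r ^ n * ω) := by
    intro x r hr
    rw [Measure.addHaar_ball _ _ hr, ENNReal.ofReal_mul (by positivity), hω,
      ENNReal.ofReal_toReal hωtop]
    simp
  set ε : ℝ := min 1 (2 / (D * ω)) with hε
  have hεpos : 0 < ε := lt_min one_pos (by positivity)
  have hε1 : ε ≤ 1 := min_le_left _ _
  have hε2 : ω * ε * D ≤ 2 := by
    have : ε ≤ 2 / (D * ω) := min_le_right _ _
    rw [le_div_iff₀ (by positivity)] at this
    linarith
  have hCpos : 0 < 4 / (ε * ω ^ 2 * c) := by positivity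
  refine ⟨(4 / (ε * ω ^ 2 * c)).toNNReal, by simpa using hCpos, ?_⟩
  intro f hf t hA0 hAt
  set A : Set (EuclideanSpace ℝ (Fin n)) := {x | t < |f x|} with hA
  have hAm : MeasurableSet A := measurableSet_lt measurable_const hf.abs
  set m : ℝ := (volume A).toReal with hm
  have hmpos : 0 < m := ENNReal.toReal_pos hA0 hAt
  have hmA : volume A = ENNReal.ofReal m := (ENNReal.ofReal_toReal hAt).symm
  set R : ℝ := (2 * m / ω) ^ ((n : ℝ)⁻¹) with hR
  have hRpos : 0 < R := by positivity
  have hRn : R ^ n = 2 * m / ω := by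
    rw [hR]; exact Real.rpow_inv_natCast_pow (by positivity) (by omega)
  obtain ⟨k, hk, hkK, hN⟩ := hKN R hRpos
  set P := levP volume (fun x y => Kr (dist x y)) f t with hP
  have hPge : ENNReal.ofReal (m * (m * k)) ≤ P := by
    have hin : ∀ x ∈ A, ENNReal.ofReal (m * k) ≤
        ∫⁻ y, levG (fun x y => Kr (dist x y)) f t x y := by
      intro x hx
      have hvol : ENNReal.ofReal m ≤ volume (Metric.ball x R \ A) := by
        calc ENNReal.ofReal m = ENNReal.ofReal (2 * m) - ENNReal.ofReal m := by
              rw [← ENNReal.ofReal_sub _ hmpos.le]; congr 1; ring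
          _ = volume (Metric.ball x R) - volume A := by
              rw [hball x R hRpos.le, hRn, hmA]; congr 2; field_simp
          _ ≤ _ := le_measure_sdiff
      calc ENNReal.ofReal (m * k) = ENNReal.ofReal k * ENNReal.ofReal m := by
            rw [← ENNReal.ofReal_mul hk.le, mul_comm]
        _ ≤ ENNReal.ofReal k * volume (Metric.ball x R \ A) := by gcongr
        _ = ∫⁻ y, (Metric.ball x R \ A).indicator (fun _ => ENNReal.ofReal k) y := by
            rw [lintegral_indicator_const (Metric.isOpen_ball.measurableSet.diff hAm)]
        _ ≤ _ := by
            refine lintegral_mono fun y => ?_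
            by_cases hy : y ∈ Metric.ball x R \ A
            · rw [indicator_of_mem hy]
              have hyA : |f y| ≤ t := not_lt.1 hy.2
              have hxt : t < |f x| := hx
              simp only [levG, hyA, hxt, and_self, if_true]
              apply hkK
              · rw [dist_pos]; rintro rfl; exact hy.2 hx
              · rw [dist_comm]; exact (Metric.mem_ball.1 hy.1).le
            · rw [indicator_of_notMem hy]; exact zero_le
    calc ENNReal.ofReal (m * (m * k)) = ENNReal.ofReal (m * k) * volume A := by
          rw [hmA, ← ENNReal.ofReal_mul (by positivity), mul_comm]
      _ = ∫⁻ x, A.indicator (fun _ => ENNReal.ofReal (m * k)) x := by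
          rw [lintegral_indicator_const hAm]
      _ ≤ P := by
          refine lintegral_mono fun x => ?_
          by_cases hx : x ∈ A
          · rw [indicator_of_mem hx]; exact hin x hx
          · rw [indicator_of_notMem hx]; exact zero_le
  have hmk : 0 < m * (m * k) := by positivity
  refine ⟨(lt_of_lt_of_le (ENNReal.ofReal_pos.2 hmk) hPge).ne', fun hPt => ?_⟩
  have hPr : m * (m * k) ≤ P.toReal := (ENNReal.ofReal_le_iff_le_toReal hPt).1 hPge
  have hle : ((4 / (ε * ω ^ 2 * c)).toNNReal * P.toNNReal)⁻¹ ≤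
      ε.toNNReal * (c / (R ^ (2 * n) * k)).toNNReal := by
    rw [← NNReal.coe_le_coe]
    push_cast
    rw [Real.coe_toNNReal _ hCpos.le, Real.coe_toNNReal _ hεpos.le,
      Real.coe_toNNReal _ (by positivity)]
    calc (4 / (ε * ω ^ 2 * c) * P.toReal)⁻¹ ≤ (4 / (ε * ω ^ 2 * c) * (m * (m * k)))⁻¹ := by
          gcongr
      _ = _ := by
          rw [mul_comm 2 n, pow_mul, hRn]
          field_simp
          ring
  calc volume A * N.toFun (((4 / (ε * ω ^ 2 * c)).toNNReal * P.toNNReal)⁻¹)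
      ≤ ENNReal.ofReal m * (ENNReal.ofReal ε * ENNReal.ofReal (D / R ^ n)) := by
        rw [hmA]
        gcongr
        refine (N.mono hle).trans ((N.scale _ _ (by simpa using hε1)).trans ?_)
        exact mul_le_mul_right hN _
    _ = ENNReal.ofReal (ω * ε * D / 2) := by
        rw [← ENNReal.ofReal_mul hεpos.le, ← ENNReal.ofReal_mul hmpos.le, hRn]
        congr 1; field_simp
    _ ≤ 1 := by
        rw [← ENNReal.ofReal_one]
        apply ENNReal.ofReal_le_ofReal; linarith

lemma finite_level {E : Type*} [MeasurableSpace E] {μ : Measure E} {f : E → ℝ}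
    (N : YoungFunction) (hpos : ∀ s, 0 < s → N.toFun s ≠ 0) (hf : Measurable f)
    (h : orliczNorm μ N.toFun f < ∞) (t : ℝ) (ht : 0 < t) : μ {x | t < |f x|} ≠ ∞ := by
  unfold orliczNorm at h
  simp only [iInf_lt_iff] at h
  obtain ⟨r, ⟨hr, hI⟩, -⟩ := h
  have hm : Measurable (fun x => N.toFun (‖f x‖₊ / r)) :=
    N.mono.measurable.comp (hf.nnnorm.div_const r)
  have hN0 : N.toFun (t.toNNReal / r) ≠ 0 := hpos _ (div_pos (by simpa using ht) hr)
  have h1 := (mul_meas_ge_le_lintegral (μ := μ) hm (N.toFun (t.toNNReal / r))).trans hI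
  have h2 : μ {x | t < |f x|} ≤ μ {x | N.toFun (t.toNNReal / r) ≤ N.toFun (‖f x‖₊ / r)} := by
    apply measure_mono
    intro x hx
    apply N.mono
    gcongr
    rw [← NNReal.coe_le_coe, Real.coe_toNNReal _ ht.le, coe_nnnorm, Real.norm_eq_abs]
    exact le_of_lt hx
  refine ne_top_of_le_ne_top ?_ h2
  intro h3
  rw [h3, ENNReal.mul_top hN0] at h1
  exact absurd h1 (by simp)

lemma abstract_main (n : ℕ) (hn : 1 ≤ n) (Kr : ℝ → ℝ≥0∞) (hKr : Measurable Kr)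
    (N : YoungFunction) (hfin : ∀ s, N.toFun s ≠ ∞) (hpos : ∀ s, 0 < s → N.toFun s ≠ 0)
    (c D : ℝ) (hc : 0 < c) (hD : 0 < D)
    (hKN : ∀ R : ℝ, 0 < R → ∃ k : ℝ, 0 < k ∧
      (∀ r : ℝ, 0 < r → r ≤ R → ENNReal.ofReal k ≤ Kr r) ∧
      N.toFun (c / (R ^ (2 * n) * k)).toNNReal ≤ ENNReal.ofReal (D / R ^ n)) :
    ∃ C : ℝ≥0, 0 < C ∧ ∀ f : EuclideanSpace ℝ (Fin n) → ℝ, Measurable f →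
      orliczNorm volume N.toFun f < ∞ →
      orliczNorm volume N.toFun f ≤ C *
        ∫⁻ x, ∫⁻ y, (‖f x - f y‖₊ : ℝ≥0∞) * Kr (dist x y) := by
  obtain ⟨C, hC, H⟩ := iso_ineq n hn Kr N c D hc hD hKN
  refine ⟨C, hC, fun f hf hfN => ?_⟩
  have hKm : Measurable (Function.uncurry
      (fun x y : EuclideanSpace ℝ (Fin n) => Kr (dist x y))) :=
    hKr.comp measurable_dist
  exact orlicz_le_of_iso hKm hf N hfin C hC
    (fun t ht h0 => H f hf t h0 (finite_level N hpos hf hfN t ht))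

lemma log_two_add_pos {u : ℝ} (hu : 0 ≤ u) : Real.log 2 ≤ Real.log (2 + u) :=
  Real.log_le_log (by norm_num) (by linarith)

/-- powers of the logarithm are dominated by any power -/
lemma log_rpow_le (s e : ℝ) (he : 0 < e) :
    ∃ B : ℝ, 0 < B ∧ ∀ u : ℝ, 0 ≤ u → Real.log (2 + u) ^ s ≤ B * (2 + u) ^ e := by
  have hl2 : 0 < Real.log 2 := Real.log_pos (by norm_num)
  rcases le_or_gt s 0 with hs | hs
  · refine ⟨Real.log 2 ^ s, by positivity, fun u hu => ?_⟩
    have h1 : Real.log (2 + u) ^ s ≤ Real.log 2 ^ s :=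
      Real.rpow_le_rpow_of_nonpos hl2 (log_two_add_pos hu) hs
    have h2 : 1 ≤ (2 + u) ^ e := Real.one_le_rpow (by linarith) he.le
    have h3 : 0 < Real.log 2 ^ s := by positivity
    nlinarith
  · refine ⟨(e / s)⁻¹ ^ s, by positivity, fun u hu => ?_⟩
    have h1 : Real.log (2 + u) ≤ (2 + u) ^ (e / s) / (e / s) :=
      Real.log_le_rpow_div (by linarith) (by positivity)
    have h0 : 0 ≤ Real.log (2 + u) := hl2.le.trans (log_two_add_pos hu)
    calc Real.log (2 + u) ^ s ≤ ((2 + u) ^ (e / s) / (e / s)) ^ s :=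
          Real.rpow_le_rpow h0 h1 hs.le
      _ = (e / s)⁻¹ ^ s * (2 + u) ^ e := by
          rw [div_eq_inv_mul, Real.mul_rpow (by positivity) (by positivity),
            ← Real.rpow_mul (by linarith), div_mul_cancel₀ _ hs.ne']

/-- slow variation of the logarithm -/
lemma log_slow (a g : ℝ) (ha : 0 ≤ a) (hg : 0 < g) :
    ∃ B : ℝ, 0 < B ∧ ∀ x u : ℝ, 1 ≤ x → 0 < u →
      Real.log (2 + x * u) ^ a ≤ B * x ^ g * Real.log (2 + u) ^ a := by
  obtain ⟨B, hB, H⟩ := log_rpow_le a g hg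
  have hl2 : 0 < Real.log 2 := Real.log_pos (by norm_num)
  refine ⟨B * 3 ^ g * (2 / Real.log 2) ^ a, by positivity, fun x u hx hu => ?_⟩
  have hLu := log_two_add_pos hu.le
  have hLx : Real.log 2 ≤ Real.log (2 + x) := log_two_add_pos (by linarith)
  have h1 : Real.log (2 + x * u) ≤ (2 / Real.log 2) * (Real.log (2 + x) * Real.log (2 + u)) := by
    have h2 : Real.log (2 + x * u) ≤ Real.log (2 + x) + Real.log (2 + u) := by
      rw [← Real.log_mul (by positivity) (by positivity)]
      apply Real.log_le_log (by positivity); nlinarith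
    rw [div_mul_eq_mul_div, le_div_iff₀ hl2]
    nlinarith
  have h3 : 0 ≤ Real.log (2 + x * u) := hl2.le.trans (log_two_add_pos (by positivity))
  have hx0 : 0 ≤ x := by linarith
  calc Real.log (2 + x * u) ^ a
      ≤ ((2 / Real.log 2) * (Real.log (2 + x) * Real.log (2 + u))) ^ a :=
        Real.rpow_le_rpow h3 h1 ha
    _ = (2 / Real.log 2) ^ a * (Real.log (2 + x) ^ a * Real.log (2 + u) ^ a) := by
        rw [Real.mul_rpow (by positivity) (by nlinarith),
          Real.mul_rpow (by linarith) (by linarith)]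
    _ ≤ (2 / Real.log 2) ^ a * ((B * (3 * x) ^ g) * Real.log (2 + u) ^ a) := by
        have : 0 < Real.log (2 + u) := by linarith
        gcongr
        refine (H x hx0).trans ?_
        gcongr
        linarith
    _ = _ := by rw [Real.mul_rpow (by norm_num) hx0]; ring

/-- comparison of the two logarithms -/
lemma log_compare (b σ q lam : ℝ) (hb : 0 < b) (hlam : 2 ≤ lam) :
    ∃ B : ℝ, 0 < B ∧ ∀ u : ℝ, 0 < u →
      Real.log (lam + u ^ b * Real.log (2 + u) ^ σ) ^ q ≤ B * Real.log (2 + u) ^ q := by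
  have hl2 : 0 < Real.log 2 := Real.log_pos (by norm_num)
  -- two sided comparison
  obtain ⟨B₁, hB₁, H₁⟩ : ∃ B : ℝ, 0 < B ∧ ∀ u : ℝ, 0 < u →
      Real.log (lam + u ^ b * Real.log (2 + u) ^ σ) ≤ B * Real.log (2 + u) := by
    obtain ⟨A, hA, H⟩ := log_rpow_le σ b hb
    refine ⟨Real.log (lam + A) / Real.log 2 + 2 * b, ?_, fun u hu => ?_⟩
    · have : 0 < Real.log (lam + A) := Real.log_pos (by linarith)
      positivity
    have hL := log_two_add_pos hu.le
    have h0 : 0 < Real.log (lam + A) := Real.log_pos (by linarith)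
    have hLp : 0 < Real.log (2 + u) := by linarith
    have h1 : lam + u ^ b * Real.log (2 + u) ^ σ ≤ (lam + A) * (2 + u) ^ (2 * b) := by
      have e1 : 1 ≤ (2 + u) ^ (2 * b) := Real.one_le_rpow (by linarith) (by positivity)
      have e2 : u ^ b * Real.log (2 + u) ^ σ ≤ A * (2 + u) ^ (2 * b) := by
        calc u ^ b * Real.log (2 + u) ^ σ ≤ (2 + u) ^ b * (A * (2 + u) ^ b) := by
              gcongr
              · linarith
              · exact H u hu.le
          _ = _ := by
              rw [two_mul b, Real.rpow_add (by linarith)]; ring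
      nlinarith
    calc Real.log (lam + u ^ b * Real.log (2 + u) ^ σ)
        ≤ Real.log ((lam + A) * (2 + u) ^ (2 * b)) := Real.log_le_log (by positivity) h1
      _ = Real.log (lam + A) + 2 * b * Real.log (2 + u) := by
          rw [Real.log_mul (by positivity) (by positivity), Real.log_rpow (by linarith)]
      _ ≤ _ := by
          rw [add_mul]
          gcongr
          rw [div_mul_eq_mul_div, le_div_iff₀ hl2]
          gcongr
  obtain ⟨B₂, hB₂, H₂⟩ : ∃ B : ℝ, 0 < B ∧ ∀ u : ℝ, 0 < u →
      Real.log (2 + u) ≤ B * Real.log (lam + u ^ b * Real.log (2 + u) ^ σ) := by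
    obtain ⟨A, hA, H⟩ := log_rpow_le (-σ) (b / 2) (by positivity)
    -- `(2+u)^(b/2) ≤ M * (lam + v)`
    set M : ℝ := 4 ^ (b / 2) + 2 ^ b * A with hM
    have hMpos : 1 ≤ M := by
      have : (1:ℝ) ≤ 4 ^ (b / 2) := Real.one_le_rpow (by norm_num) (by positivity)
      have : 0 < 2 ^ b * A := by positivity
      linarith
    refine ⟨(Real.log M / Real.log 2 + 1) / (b / 2), ?_, fun u hu => ?_⟩
    · have : 0 ≤ Real.log M := Real.log_nonneg hMpos
      positivity
    have hL := log_two_add_pos hu.le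
    have hLp : 0 < Real.log (2 + u) := by linarith
    set v := u ^ b * Real.log (2 + u) ^ σ with hv
    have hvpos : 0 < v := by positivity
    have h1 : (2 + u) ^ (b / 2) ≤ M * (lam + v) := by
      rcases le_or_gt u 2 with h | h
      · have e1 : (2 + u) ^ (b / 2) ≤ 4 ^ (b / 2) := by gcongr; linarith
        have e2 : 0 < 2 ^ b * A := by positivity
        have e3 : (0:ℝ) < 4 ^ (b / 2) := by positivity
        nlinarith
      · have e1 : (2 + u) ^ (b / 2) * (2 + u) ^ (b / 2) ≤ 2 ^ b * u ^ b := by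
          rw [← Real.rpow_add (by linarith), add_halves, ← Real.mul_rpow (by norm_num) hu.le]
          gcongr; linarith
        have e2 : 1 ≤ A * (2 + u) ^ (b / 2) * Real.log (2 + u) ^ σ := by
          have := H u hu.le
          rw [Real.rpow_neg hLp.le, inv_le_iff_one_le_mul₀ (by positivity)] at this
          linarith
        have e3 : (0:ℝ) < (2 + u) ^ (b / 2) := by positivity
        have e4 : 0 < Real.log (2 + u) ^ σ := by positivity
        have e6 : (0:ℝ) < 4 ^ (b / 2) := by positivity
        calc (2 + u) ^ (b / 2) ≤ (2 + u) ^ (b / 2) *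
              (A * (2 + u) ^ (b / 2) * Real.log (2 + u) ^ σ) := le_mul_of_one_le_right e3.le e2
          _ = A * ((2 + u) ^ (b / 2) * (2 + u) ^ (b / 2)) * Real.log (2 + u) ^ σ := by ring
          _ ≤ A * (2 ^ b * u ^ b) * Real.log (2 + u) ^ σ := by gcongr
          _ = (2 ^ b * A) * v := by rw [hv]; ring
          _ ≤ M * (lam + v) := by
              apply mul_le_mul _ (by linarith) hvpos.le (by linarith)
              linarith
    have h2 := Real.log_le_log (by positivity) h1
    rw [Real.log_rpow (by linarith), Real.log_mul (by positivity) (by positivity)] at h2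
    have h3 : Real.log 2 ≤ Real.log (lam + v) := Real.log_le_log (by norm_num) (by linarith)
    have h4 : 0 ≤ Real.log M := Real.log_nonneg hMpos
    rw [div_mul_eq_mul_div, le_div_iff₀ (by positivity), add_mul, one_mul]
    have h5 : Real.log M ≤ Real.log M / Real.log 2 * Real.log (lam + v) := by
      rw [div_mul_eq_mul_div, le_div_iff₀ hl2]
      gcongr
    linarith
  rcases le_or_gt 0 q with hq | hq
  · refine ⟨B₁ ^ q, by positivity, fun u hu => ?_⟩
    have hL := log_two_add_pos hu.le
    have hLp : 0 < Real.log (2 + u) := by linarith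
    have hv : 0 < u ^ b * Real.log (2 + u) ^ σ := by positivity
    rw [← Real.mul_rpow hB₁.le hLp.le]
    exact Real.rpow_le_rpow (Real.log_nonneg (by linarith)) (H₁ u hu) hq
  · refine ⟨(B₂⁻¹) ^ q, by positivity, fun u hu => ?_⟩
    have hL := log_two_add_pos hu.le
    have hLp : 0 < Real.log (2 + u) := by linarith
    rw [← Real.mul_rpow (by positivity) hLp.le]
    refine Real.rpow_le_rpow_of_nonpos (by positivity) ?_ hq.le
    rw [inv_mul_le_iff₀ hB₂]
    exact H₂ u hu

lemma semi_main (n : ℕ) (hn : 1 ≤ n) (α : ℝ) (hα : α ∈ Ioo (0 : ℝ) 2) (l : ℝ → ℝ)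
    (hlm : Measurable l) (hl : ∀ r, 0 < r → 0 < l r)
    (N : YoungFunction) (hfin : ∀ s, N.toFun s ≠ ∞) (hpos : ∀ s, 0 < s → N.toFun s ≠ 0)
    (c B : ℝ) (hc : 0 < c) (hB : 0 < B)
    (hslow : ∀ r R : ℝ, 0 < r → r ≤ R →
      c * (l R / R ^ ((n : ℝ) + α / 2)) ≤ l r / r ^ ((n : ℝ) + α / 2))
    (hN : ∀ R : ℝ, 0 < R → N.toFun ((R ^ ((n : ℝ) - α / 2) * l R)⁻¹).toNNReal ≤
      ENNReal.ofReal ((B / R ^ ((n : ℝ) - α / 2)) ^ ((n : ℝ) / ((n : ℝ) - α / 2)))) :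
    ∃ C : ℝ≥0, 0 < C ∧ ∀ f : EuclideanSpace ℝ (Fin n) → ℝ, Measurable f →
      orliczNorm volume N.toFun f < ∞ →
      orliczNorm volume N.toFun f ≤ C *
        ∫⁻ x, ∫⁻ y, (‖f x - f y‖₊ : ℝ≥0∞) *
          ENNReal.ofReal (l (dist x y) / dist x y ^ ((n : ℝ) + α / 2)) := by
  have hn' : (1:ℝ) ≤ n := by exact_mod_cast hn
  have hβ : 0 < (n:ℝ) - α / 2 := by have := hα.2; linarith
  refine abstract_main n hn (fun r => ENNReal.ofReal (l r / r ^ ((n : ℝ) + α / 2))) ?_ N hfin hpos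
    c (B ^ ((n : ℝ) / ((n : ℝ) - α / 2))) hc (by positivity) ?_
  · exact (hlm.div (measurable_id.pow_const _)).ennreal_ofReal
  · intro R hR
    have hlR := hl R hR
    refine ⟨c * (l R / R ^ ((n : ℝ) + α / 2)), by positivity, ?_, ?_⟩
    · intro r hr hrR
      exact ENNReal.ofReal_le_ofReal (hslow r R hr hrR)
    · have e1 : R ^ (2 * n) = R ^ ((n : ℝ) - α / 2) * R ^ ((n : ℝ) + α / 2) := by
        rw [← Real.rpow_add hR, ← Real.rpow_natCast]
        congr 1; push_cast; ring
      have e2 : c / (R ^ (2 * n) * (c * (l R / R ^ ((n : ℝ) + α / 2)))) =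
          (R ^ ((n : ℝ) - α / 2) * l R)⁻¹ := by
        rw [e1]
        have : 0 < R ^ ((n : ℝ) + α / 2) := by positivity
        have : 0 < R ^ ((n : ℝ) - α / 2) := by positivity
        field_simp
      rw [e2]
      refine (hN R hR).trans (le_of_eq ?_)
      congr 1
      rw [Real.div_rpow hB.le (by positivity), ← Real.rpow_mul hR.le, mul_div_cancel₀ _ hβ.ne',
        Real.rpow_natCast]

/-- logarithmically refined Orlicz–Sobolev type isoperimetric
inequalities for the `α/2`-stable kernel, with Young functions
`N_α^{log,q,+}(s) = (s log^q(λ+s))^{n/(n-α/2)}` and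
`N_α^{log,p,-}(s) = (s log^p(λ+s⁻¹))^{n/(n-α/2)}`. -/
theorem orliczSobolev_log_stable
    (n : ℕ) (hn : 1 ≤ n) (α : ℝ) (hα : α ∈ Ioo (0 : ℝ) 2)
    (q p : ℝ) (lam : ℝ) (hlam : 2 ≤ lam)
    (NYq NYp : YoungFunction)
    (hNYq : NYq.toFun = fun s : ℝ≥0 =>
      ENNReal.ofReal (((s : ℝ) * Real.log (lam + (s : ℝ)) ^ q) ^
        ((n : ℝ) / ((n : ℝ) - α / 2))))
    (hNYp : NYp.toFun = fun s : ℝ≥0 =>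
      ENNReal.ofReal (((s : ℝ) * Real.log (lam + ((s : ℝ))⁻¹) ^ p) ^
        ((n : ℝ) / ((n : ℝ) - α / 2)))) :
    ∃ C : ℝ, 0 < C ∧
      (∀ f : EuclideanSpace ℝ (Fin n) → ℝ, Measurable f →
        orliczNorm volume NYq.toFun f < ∞ →
        orliczNorm volume NYq.toFun f ≤ ENNReal.ofReal C *
          ∫⁻ x, (∫⁻ y, (‖f x - f y‖₊ : ℝ≥0∞) *
            ENNReal.ofReal (Real.log (2 + (dist x y)⁻¹) ^ q /
              dist x y ^ ((n : ℝ) + α / 2)))) ∧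
      (∀ f : EuclideanSpace ℝ (Fin n) → ℝ, Measurable f →
        orliczNorm volume NYp.toFun f < ∞ →
        orliczNorm volume NYp.toFun f ≤ ENNReal.ofReal C *
          ∫⁻ x, (∫⁻ y, (‖f x - f y‖₊ : ℝ≥0∞) *
            ENNReal.ofReal (Real.log (2 + dist x y) ^ p /
              dist x y ^ ((n : ℝ) + α / 2)))) := by
  have hn' : (1:ℝ) ≤ n := by exact_mod_cast hn
  have hβ : 0 < (n:ℝ) - α / 2 := by have := hα.2; linarith
  have hγ : 0 < (n:ℝ) + α / 2 := by have := hα.1; linarith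
  have hl2 : 0 < Real.log 2 := Real.log_pos (by norm_num)
  have hLpos : ∀ u : ℝ, 0 ≤ u → 0 < Real.log (2 + u) :=
    fun u hu => hl2.trans_le (log_two_add_pos hu)
  have hlampos : ∀ u : ℝ, 0 ≤ u → 0 < Real.log (lam + u) :=
    fun u hu => Real.log_pos (by linarith)
  have h1 : ∃ C : ℝ≥0, 0 < C ∧ ∀ f : EuclideanSpace ℝ (Fin n) → ℝ, Measurable f →
      orliczNorm volume NYq.toFun f < ∞ →
      orliczNorm volume NYq.toFun f ≤ C *
        ∫⁻ x, ∫⁻ y, (‖f x - f y‖₊ : ℝ≥0∞) *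
          ENNReal.ofReal (Real.log (2 + (dist x y)⁻¹) ^ q / dist x y ^ ((n : ℝ) + α / 2)) := by
    obtain ⟨B, hB, HB⟩ := log_compare ((n:ℝ) - α / 2) (-q) q lam hβ hlam
    obtain ⟨c, hc, Hc⟩ : ∃ c : ℝ, 0 < c ∧ ∀ r R : ℝ, 0 < r → r ≤ R →
        c * (Real.log (2 + R⁻¹) ^ q / R ^ ((n : ℝ) + α / 2)) ≤
          Real.log (2 + r⁻¹) ^ q / r ^ ((n : ℝ) + α / 2) := by
      rcases le_or_gt 0 q with hq | hq
      · refine ⟨1, one_pos, fun r R hr hrR => ?_⟩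
        have hR : 0 < R := hr.trans_le hrR
        have := hLpos R⁻¹ (by positivity)
        have := hLpos r⁻¹ (by positivity)
        rw [one_mul]
        gcongr
      · obtain ⟨M, hM, HM⟩ := log_slow (-q) ((n:ℝ) + α / 2) (by linarith) hγ
        refine ⟨M⁻¹, by positivity, fun r R hr hrR => ?_⟩
        have hR : 0 < R := hr.trans_le hrR
        have h := HM (R / r) R⁻¹ (by rw [le_div_iff₀ hr]; linarith) (by positivity)
        have e : R / r * R⁻¹ = r⁻¹ := by field_simp
        have p1 := hLpos R⁻¹ (by positivity)
        have p2 := hLpos r⁻¹ (by positivity)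
        rw [e, Real.rpow_neg p1.le, Real.rpow_neg p2.le, Real.div_rpow hR.le hr.le] at h
        have q1 : 0 < Real.log (2 + R⁻¹) ^ q := by positivity
        have q2 : 0 < Real.log (2 + r⁻¹) ^ q := by positivity
        have q3 : 0 < R ^ ((n : ℝ) + α / 2) := by positivity
        have q4 : 0 < r ^ ((n : ℝ) + α / 2) := by positivity
        generalize Real.log (2 + R⁻¹) ^ q = a1 at *
        generalize Real.log (2 + r⁻¹) ^ q = a2 at *
        generalize R ^ ((n : ℝ) + α / 2) = a3 at *
        generalize r ^ ((n : ℝ) + α / 2) = a4 at *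
        field_simp at h ⊢
        linarith
    refine semi_main n hn α hα (fun r => Real.log (2 + r⁻¹) ^ q) ?_ ?_ NYq ?_ ?_ c B hc hB Hc ?_
    · exact (Real.measurable_log.comp (measurable_const.add measurable_inv)).pow_const _
    · intro r hr
      have := hLpos r⁻¹ (by positivity)
      positivity
    · intro s; rw [hNYq]; exact ENNReal.ofReal_ne_top
    · intro s hs
      rw [hNYq]
      have hs' : 0 < (s:ℝ) := by exact_mod_cast hs
      have := hlampos s hs'.le
      exact (ENNReal.ofReal_pos.2 (by positivity)).ne'
    · intro R hR
      have p1 := hLpos R⁻¹ (by positivity)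
      have h := HB R⁻¹ (by positivity)
      rw [hNYq]
      have e : (R ^ ((n : ℝ) - α / 2) * Real.log (2 + R⁻¹) ^ q)⁻¹ =
          R⁻¹ ^ ((n : ℝ) - α / 2) * Real.log (2 + R⁻¹) ^ (-q) := by
        rw [mul_inv, Real.inv_rpow hR.le, Real.rpow_neg p1.le]
      simp only []
      rw [Real.coe_toNNReal _ (by positivity)]
      apply ENNReal.ofReal_le_ofReal
      have p2 := hlampos (R ^ ((n : ℝ) - α / 2) * Real.log (2 + R⁻¹) ^ q)⁻¹ (by positivity)
      apply Real.rpow_le_rpow (by positivity) _ (by positivity)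
      rw [← e] at h
      refine (mul_le_mul_of_nonneg_left h (by positivity)).trans (le_of_eq ?_)
      have q1 : 0 < Real.log (2 + R⁻¹) ^ q := by positivity
      have q3 : 0 < R ^ ((n : ℝ) - α / 2) := by positivity
      generalize Real.log (2 + R⁻¹) ^ q = a1 at *
      field_simp
  have h2 : ∃ C : ℝ≥0, 0 < C ∧ ∀ f : EuclideanSpace ℝ (Fin n) → ℝ, Measurable f →
      orliczNorm volume NYp.toFun f < ∞ →
      orliczNorm volume NYp.toFun f ≤ C *
        ∫⁻ x, ∫⁻ y, (‖f x - f y‖₊ : ℝ≥0∞) *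
          ENNReal.ofReal (Real.log (2 + dist x y) ^ p / dist x y ^ ((n : ℝ) + α / 2)) := by
    obtain ⟨B, hB, HB⟩ := log_compare ((n:ℝ) - α / 2) p p lam hβ hlam
    obtain ⟨c, hc, Hc⟩ : ∃ c : ℝ, 0 < c ∧ ∀ r R : ℝ, 0 < r → r ≤ R →
        c * (Real.log (2 + R) ^ p / R ^ ((n : ℝ) + α / 2)) ≤
          Real.log (2 + r) ^ p / r ^ ((n : ℝ) + α / 2) := by
      rcases le_or_gt p 0 with hp | hp
      · refine ⟨1, one_pos, fun r R hr hrR => ?_⟩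
        have hR : 0 < R := hr.trans_le hrR
        have p1 := hLpos R hR.le
        have p2 := hLpos r hr.le
        rw [one_mul]
        have h3 : Real.log (2 + R) ^ p ≤ Real.log (2 + r) ^ p :=
          Real.rpow_le_rpow_of_nonpos p2 (Real.log_le_log (by positivity) (by linarith)) hp
        gcongr
      · obtain ⟨M, hM, HM⟩ := log_slow p ((n:ℝ) + α / 2) hp.le hγ
        refine ⟨M⁻¹, by positivity, fun r R hr hrR => ?_⟩
        have hR : 0 < R := hr.trans_le hrR
        have h := HM (R / r) r (by rw [le_div_iff₀ hr]; linarith) hr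
        have e : R / r * r = R := by field_simp
        have p1 := hLpos R hR.le
        have p2 := hLpos r hr.le
        rw [e, Real.div_rpow hR.le hr.le] at h
        have q1 : 0 < Real.log (2 + R) ^ p := by positivity
        have q2 : 0 < Real.log (2 + r) ^ p := by positivity
        have q3 : 0 < R ^ ((n : ℝ) + α / 2) := by positivity
        have q4 : 0 < r ^ ((n : ℝ) + α / 2) := by positivity
        generalize Real.log (2 + R) ^ p = a1 at *
        generalize Real.log (2 + r) ^ p = a2 at *
        generalize R ^ ((n : ℝ) + α / 2) = a3 at *
        generalize r ^ ((n : ℝ) + α / 2) = a4 at *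
        field_simp at h ⊢
        linarith
    refine semi_main n hn α hα (fun r => Real.log (2 + r) ^ p) ?_ ?_ NYp ?_ ?_ c B hc hB Hc ?_
    · exact (Real.measurable_log.comp (measurable_const.add measurable_id)).pow_const _
    · intro r hr
      have := hLpos r hr.le
      positivity
    · intro s; rw [hNYp]; exact ENNReal.ofReal_ne_top
    · intro s hs
      rw [hNYp]
      have hs' : 0 < (s:ℝ) := by exact_mod_cast hs
      have := hlampos (s:ℝ)⁻¹ (by positivity)
      exact (ENNReal.ofReal_pos.2 (by positivity)).ne'
    · intro R hR
      have p1 := hLpos R hR.le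
      have h := HB R hR
      rw [hNYp]
      simp only []
      rw [Real.coe_toNNReal _ (by positivity), inv_inv]
      apply ENNReal.ofReal_le_ofReal
      have p2 := hlampos (R ^ ((n : ℝ) - α / 2) * Real.log (2 + R) ^ p) (by positivity)
      apply Real.rpow_le_rpow (by positivity) _ (by positivity)
      refine (mul_le_mul_of_nonneg_left h (by positivity)).trans (le_of_eq ?_)
      have q1 : 0 < Real.log (2 + R) ^ p := by positivity
      have q3 : 0 < R ^ ((n : ℝ) - α / 2) := by positivity
      generalize Real.log (2 + R) ^ p = a1 at *
      field_simp
  obtain ⟨C₁, hC₁, H₁⟩ := h1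
  obtain ⟨C₂, hC₂, H₂⟩ := h2
  refine ⟨((C₁ + C₂ : ℝ≥0) : ℝ), by positivity, fun f hf hN => ?_, fun f hf hN => ?_⟩
  · refine (H₁ f hf hN).trans ?_
    rw [ENNReal.ofReal_coe_nnreal]
    gcongr
    exact le_self_add
  · refine (H₂ f hf hN).trans ?_
    rw [ENNReal.ofReal_coe_nnreal]
    gcongr
    exact le_add_self
end
end

section
/- Let n ≥ 2 be an integer, α ∈ (0,2), and let h : (0,∞) → (0,∞) be such that h(s) and s/h(s) are increasing in s and Φ̃_h(s) := ∫₀ˢ dt ∫₀^{ t^{−α/n} ∨ t^{−2/n} } dr / h( r^{1/α} ∧ r^{1/2} ) < ∞ for all s > 0. Then Ñ_h := Φ̃_h^{-1} is a Young function and there exists a constant C > 0 such that ‖f‖_{Ñ_h} ≤ C ∫_{{|x−y|≤1}} |f(x) − f(y)| · h(|x−y|) / |x−y|^{n+α} dx dy for all f ∈ L_{Ñ_h}(ℝⁿ). In particular, for Ñ_α(s) := s^{n/(n−α/2)} ∧ s^{n/(n−1)}, there exists a constant C > 0 such that ‖f‖_{Ñ_α} ≤ C ∫_{{|x−y|≤1}}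 |f(x) − f(y)| / |x−y|^{n+α/2} dx dy for all f ∈ L_{Ñ_α}(ℝⁿ). -/
open MeasureTheory ENNReal NNReal Filter Set

noncomputable section

/-- `Φ̃_h(s) = ∫₀ˢ dt ∫₀^{t^{-α/n} ∨ t^{-2/n}} dr / h(r^{1/α} ∧ r^{1/2})`. -/
def PhiTilde (n : ℕ) (α : ℝ) (h : ℝ → ℝ) (s : ℝ) : ℝ≥0∞ :=
  ∫⁻ t in Ioo (0 : ℝ) s,
    ∫⁻ r in Ioo (0 : ℝ) (max (t ^ (-(α / (n : ℝ)))) (t ^ (-(2 / (n : ℝ))))),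
      ENNReal.ofReal (1 / h (min (r ^ α⁻¹) (r ^ ((1 : ℝ) / 2))))

/-- `Ñ_h = Φ̃_h⁻¹`. -/
def NhTilde (n : ℕ) (α : ℝ) (h : ℝ → ℝ) (s : ℝ≥0) : ℝ≥0∞ :=
  ⨅ (u : ℝ) (_ : 0 < u ∧ (s : ℝ≥0∞) ≤ PhiTilde n α h u), ENNReal.ofReal u

/-- `Ñ_α(s) = s^{n/(n-α/2)} ∧ s^{n/(n-1)}`. -/
def Ntrunc (n : ℕ) (α : ℝ) (s : ℝ≥0) : ℝ≥0∞ :=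
  min ((s : ℝ≥0∞) ^ ((n : ℝ) / ((n : ℝ) - α / 2)))
    ((s : ℝ≥0∞) ^ ((n : ℝ) / ((n : ℝ) - 1)))

section Aux

/-- points of `A` leaving `A` under the shift by `z` -/
def omegaShift {n : ℕ} (A : Set (EuclideanSpace ℝ (Fin n))) (z : EuclideanSpace ℝ (Fin n)) :
    ℝ≥0∞ := volume {x | x ∈ A ∧ x + z ∉ A}

lemma omegaShift_add {n : ℕ} {A : Set (EuclideanSpace ℝ (Fin n))}
    (z w : EuclideanSpace ℝ (Fin n)) :
    omegaShift A (z + w) ≤ omegaShift A z + omegaShift A w := by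
  unfold omegaShift
  have h1 : volume {x | x ∈ A ∧ x + w ∉ A} =
      volume {x | x + z ∈ A ∧ x + z + w ∉ A} := by
    rw [← measure_preimage_add_right volume z {x | x ∈ A ∧ x + w ∉ A}]
    rfl
  rw [h1]
  refine le_trans (measure_mono ?_) (measure_union_le _ _)
  intro x hx
  simp only [mem_ofPred_eq, mem_union] at hx ⊢
  rw [← add_assoc] at hx
  tauto

lemma omegaShift_zero {n : ℕ} {A : Set (EuclideanSpace ℝ (Fin n))} :
    omegaShift A 0 = 0 := by
  unfold omegaShift
  simp

lemma omegaShift_smul {n : ℕ} {A : Set (EuclideanSpace ℝ (Fin n))}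
    (z : EuclideanSpace ℝ (Fin n)) (m : ℕ) :
    omegaShift A ((m : ℝ) • z) ≤ m * omegaShift A z := by
  induction m with
  | zero => simp [omegaShift_zero]
  | succ k ih =>
    push_cast
    rw [add_smul, one_smul, add_mul, one_mul]
    exact (omegaShift_add _ _).trans (add_le_add_left ih _)

lemma measurableSet_shift {n : ℕ} {A : Set (EuclideanSpace ℝ (Fin n))} (hA : MeasurableSet A) :
    MeasurableSet {q : EuclideanSpace ℝ (Fin n) × EuclideanSpace ℝ (Fin n) |
      q.2 ∈ A ∧ q.2 + q.1 ∉ A} := by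
  refine MeasurableSet.inter (measurable_snd hA) ?_
  exact ((measurable_snd.add measurable_fst) hA).compl

lemma measurable_omegaShift {n : ℕ} {A : Set (EuclideanSpace ℝ (Fin n))} (hA : MeasurableSet A) :
    Measurable (omegaShift A) :=
  measurable_measure_prodMk_left (measurableSet_shift hA)

/-- averaging lower bound -/
lemma omegaShift_avg {n : ℕ} {A : Set (EuclideanSpace ℝ (Fin n))} (hA : MeasurableSet A)
    (hfin : volume A ≠ ∞) (L : ℝ)
    (hL : 2 * volume A ≤ volume (Metric.closedBall (0 : EuclideanSpace ℝ (Fin n)) L)) :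
    volume A * volume A ≤ ∫⁻ z in Metric.closedBall (0 : EuclideanSpace ℝ (Fin n)) L,
      omegaShift A z := by
  have hS := measurableSet_shift hA
  have e1 : ∫⁻ z in Metric.closedBall (0 : EuclideanSpace ℝ (Fin n)) L, omegaShift A z
      = ∫⁻ x, volume.restrict (Metric.closedBall (0 : EuclideanSpace ℝ (Fin n)) L)
          {z | x ∈ A ∧ x + z ∉ A} := by
    have a1 := Measure.prod_apply (μ := volume.restrict (Metric.closedBall
      (0 : EuclideanSpace ℝ (Fin n)) L)) (ν := (volume : Measure (EuclideanSpace ℝ (Fin n)))) hS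
    have a2 := Measure.prod_apply_symm (μ := volume.restrict (Metric.closedBall
      (0 : EuclideanSpace ℝ (Fin n)) L)) (ν := (volume : Measure (EuclideanSpace ℝ (Fin n)))) hS
    exact a1.symm.trans a2
  rw [e1]
  calc volume A * volume A = ∫⁻ x in A, volume A := by
        rw [setLIntegral_const]
    _ ≤ ∫⁻ x in A, volume.restrict (Metric.closedBall (0 : EuclideanSpace ℝ (Fin n)) L)
          {z | x ∈ A ∧ x + z ∉ A} := by
        refine setLIntegral_mono' hA ?_
        intro x hx
        rw [Measure.restrict_apply' Metric.isClosed_closedBall.measurableSet]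
        have hv : volume ((fun z => x + z) ⁻¹' A) = volume A := measure_preimage_add _ _ _
        have := measure_mono (μ := volume) (s := Metric.closedBall (0 : EuclideanSpace ℝ (Fin n)) L)
          (t := ({z | x ∈ A ∧ x + z ∉ A} ∩ Metric.closedBall 0 L) ∪ ((fun z => x + z) ⁻¹' A))
          (by
            intro z hz
            by_cases hz' : x + z ∈ A
            · right; exact hz'
            · left; exact ⟨⟨hx, hz'⟩, hz⟩)
        have h2 := (hL.trans this).trans (measure_union_le _ _)
        rw [hv, two_mul] at h2
        exact (ENNReal.add_le_add_iff_right hfin).1 h2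
    _ ≤ _ := setLIntegral_le_lintegral _ _

/-- the scaled lower bound -/
lemma omegaShift_scaled {n : ℕ} {A : Set (EuclideanSpace ℝ (Fin n))} (hA : MeasurableSet A)
    (hfin : volume A ≠ ∞) (L : ℝ) (m : ℕ) (hm : 0 < m)
    (hL : 2 * volume A ≤ volume (Metric.closedBall (0 : EuclideanSpace ℝ (Fin n)) L)) :
    volume A * volume A ≤ (m : ℝ≥0∞) ^ (n + 1) *
      ∫⁻ z in Metric.closedBall (0 : EuclideanSpace ℝ (Fin n)) (L / m), omegaShift A z := by
  refine (omegaShift_avg hA hfin L hL).trans ?_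
  have hm' : (0 : ℝ) < m := by exact_mod_cast hm
  set B := Metric.closedBall (0 : EuclideanSpace ℝ (Fin n)) (L / m) with hB
  set F : EuclideanSpace ℝ (Fin n) → ℝ≥0∞ := B.indicator (omegaShift A) with hF
  have hFm : Measurable F := (measurable_omegaShift hA).indicator measurableSet_closedBall
  have key : ∫⁻ z, F ((m : ℝ)⁻¹ • z) = (m : ℝ≥0∞) ^ n * ∫⁻ z, F z := by
    have h1 := Measure.map_addHaar_smul (volume : Measure (EuclideanSpace ℝ (Fin n)))
      (r := (m : ℝ)⁻¹) (inv_ne_zero hm'.ne')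
    have h2 := lintegral_map (μ := (volume : Measure (EuclideanSpace ℝ (Fin n)))) hFm
      (measurable_const_smul (m : ℝ)⁻¹)
    rw [h1, lintegral_smul_measure] at h2
    rw [← h2]
    simp only [finrank_euclideanSpace, Fintype.card_fin, inv_pow, inv_inv, smul_eq_mul]
    rw [abs_of_pos (by positivity), ENNReal.ofReal_pow hm'.le, ENNReal.ofReal_natCast]
  calc ∫⁻ z in Metric.closedBall (0 : EuclideanSpace ℝ (Fin n)) L, omegaShift A z
      ≤ ∫⁻ z, m * F ((m : ℝ)⁻¹ • z) := by
        rw [← lintegral_indicator measurableSet_closedBall]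
        refine lintegral_mono fun z => ?_
        by_cases hz : z ∈ Metric.closedBall (0 : EuclideanSpace ℝ (Fin n)) L
        · have hz2 : (m : ℝ)⁻¹ • z ∈ B := by
            rw [mem_closedBall_zero_iff] at hz ⊢
            rw [norm_smul, norm_inv, Real.norm_natCast, div_eq_inv_mul]
            gcongr
          rw [indicator_of_mem hz, hF, indicator_of_mem hz2]
          have := omegaShift_smul (A := A) ((m : ℝ)⁻¹ • z) m
          rwa [smul_smul, mul_inv_cancel₀ hm'.ne', one_smul] at this
        · rw [indicator_of_notMem hz]; exact zero_le
    _ = m * ∫⁻ z, F ((m : ℝ)⁻¹ • z) := lintegral_const_mul _ (hFm.comp (measurable_const_smul _))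
    _ = _ := by
        rw [key, hF, lintegral_indicator measurableSet_closedBall, pow_succ]
        ring

/-- the truncated kernel -/
def kerTrunc (n : ℕ) (α : ℝ) (h : ℝ → ℝ) (z : EuclideanSpace ℝ (Fin n)) : ℝ≥0∞ :=
  {z : EuclideanSpace ℝ (Fin n) | 0 < ‖z‖ ∧ ‖z‖ ≤ 1}.indicator
    (fun z => ENNReal.ofReal (h ‖z‖ / ‖z‖ ^ ((n : ℝ) + α))) z

lemma measurable_kerTrunc (n : ℕ) (α : ℝ) (h : ℝ → ℝ) (hpos : ∀ s : ℝ, 0 < s → 0 < h s)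
    (hmono : MonotoneOn h (Ioi (0 : ℝ))) : Measurable (kerTrunc n α h) := by
  have hm : Monotone (fun t : ℝ => if 0 < t then h t else 0) := by
    intro a b hab
    dsimp only
    split_ifs with h1 h2 h2
    · exact hmono h1 h2 hab
    · exact absurd (lt_of_lt_of_le h1 hab) h2
    · exact (hpos _ h2).le
    · exact le_rfl
  have hS : MeasurableSet {z : EuclideanSpace ℝ (Fin n) | 0 < ‖z‖ ∧ ‖z‖ ≤ 1} :=
    (measurableSet_lt measurable_const measurable_norm).inter
      (measurableSet_le measurable_norm measurable_const)
  have e : kerTrunc n α h = {z : EuclideanSpace ℝ (Fin n) | 0 < ‖z‖ ∧ ‖z‖ ≤ 1}.indicator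
      (fun z => ENNReal.ofReal ((fun t : ℝ => if 0 < t then h t else 0) ‖z‖
        / ‖z‖ ^ ((n : ℝ) + α))) := by
    funext z
    unfold kerTrunc
    by_cases hz : z ∈ {z : EuclideanSpace ℝ (Fin n) | 0 < ‖z‖ ∧ ‖z‖ ≤ 1}
    · rw [indicator_of_mem hz, indicator_of_mem hz]
      simp only [if_pos hz.1]
    · rw [indicator_of_notMem hz, indicator_of_notMem hz]
  rw [e]
  refine Measurable.indicator ?_ hS
  exact ((hm.measurable.comp measurable_norm).div (measurable_norm.pow_const _)).ennreal_ofReal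

lemma ker_antitone (n : ℕ) (hn : 2 ≤ n) (α : ℝ) (hα : α ∈ Ioo (0 : ℝ) 2)
    (h : ℝ → ℝ) (hpos : ∀ s : ℝ, 0 < s → 0 < h s)
    (hmono' : MonotoneOn (fun s => s / h s) (Ioi (0 : ℝ))) {a b : ℝ} (ha : 0 < a) (hab : a ≤ b) :
    h b / b ^ ((n : ℝ) + α) ≤ h a / a ^ ((n : ℝ) + α) := by
  have hb : 0 < b := ha.trans_le hab
  have h1 : a / h a ≤ b / h b := hmono' ha hb hab
  have h2 : h b / b ≤ h a / a := by
    rw [div_le_div_iff₀ (hpos _ ha) (hpos _ hb)] at h1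
    rw [div_le_div_iff₀ hb ha]
    linarith
  have e : ∀ c : ℝ, 0 < c → h c / c ^ ((n : ℝ) + α) = (h c / c) * (c ^ ((n : ℝ) + α - 1))⁻¹ := by
    intro c hc
    rw [Real.rpow_sub_one hc.ne']
    have : c ^ ((n : ℝ) + α) ≠ 0 := (Real.rpow_pos_of_pos hc _).ne'
    field_simp
  rw [e a ha, e b hb]
  have hn' : (2 : ℝ) ≤ n := by exact_mod_cast hn
  have h3 : a ^ ((n : ℝ) + α - 1) ≤ b ^ ((n : ℝ) + α - 1) :=
    Real.rpow_le_rpow ha.le hab (by linarith [hα.1])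
  have h4 : 0 < a ^ ((n : ℝ) + α - 1) := Real.rpow_pos_of_pos ha _
  have := hpos a ha
  gcongr

lemma iso_real (n : ℕ) (α : ℝ) (hα : α ∈ Ioo (0 : ℝ) 2)
    (h : ℝ → ℝ) (hpos : ∀ s : ℝ, 0 < s → 0 < h s)
    (hmono : MonotoneOn h (Ioi (0 : ℝ)))
    (hmono' : MonotoneOn (fun s => s / h s) (Ioi (0 : ℝ))) (R : ℝ) (hR : 1 ≤ R)
    (ρ : ℝ) (hρ : 0 < ρ) :
    ∃ m : ℕ, 0 < m ∧ R * ρ / m ≤ 1 ∧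
      (m : ℝ) ^ (n + 1) ≤ (2 * R) ^ (n + 2) * (ρ ^ n *
        (h (R * ρ / m) / (R * ρ / m) ^ ((n : ℝ) + α))) * (max (ρ ^ α) (ρ ^ 2) / h ρ) := by
  have hR0 : 0 < R := by linarith
  have hRρ : 0 < R * ρ := by positivity
  have hhρ := hpos ρ hρ
  rcases le_or_gt (R * ρ) 1 with hc | hc
  · refine ⟨1, one_pos, by simpa using hc, ?_⟩
    simp only [Nat.cast_one, div_one, one_pow]
    have h1 : h ρ ≤ h (R * ρ) := hmono hρ hRρ (by nlinarith)
    have e : (R * ρ) ^ ((n : ℝ) + α) = R ^ ((n : ℝ) + α) * (ρ ^ n * ρ ^ α) := by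
      rw [Real.mul_rpow hR0.le hρ.le, Real.rpow_add hρ, Real.rpow_natCast]
    have h2 : R ^ ((n : ℝ) + α) ≤ (2 * R) ^ (n + 2) := by
      calc R ^ ((n : ℝ) + α) ≤ R ^ ((n : ℝ) + 2) :=
            Real.rpow_le_rpow_of_exponent_le hR (by linarith [hα.2])
        _ = R ^ (n + 2) := by rw [← Real.rpow_natCast]; push_cast; rfl
        _ ≤ _ := by gcongr; linarith
    have p1 : 0 < R ^ ((n : ℝ) + α) := Real.rpow_pos_of_pos hR0 _
    have p2 : 0 < ρ ^ α := Real.rpow_pos_of_pos hρ _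
    rw [e]
    calc (1 : ℝ) = R ^ ((n : ℝ) + α) * (ρ ^ n * (h ρ / (R ^ ((n : ℝ) + α) * (ρ ^ n * ρ ^ α)))) *
          (ρ ^ α / h ρ) := by field_simp
      _ ≤ _ := by
        have : ρ ^ α ≤ max (ρ ^ α) (ρ ^ 2) := le_max_left _ _
        have := hpos _ hRρ
        gcongr
  · set m := ⌈R * ρ⌉₊ with hm
    have hm1 : R * ρ ≤ m := Nat.le_ceil _
    have hm0' : (0 : ℝ) < m := hRρ.trans_le hm1
    have hm0 : 0 < m := by exact_mod_cast hm0'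
    have hm2 : (m : ℝ) ≤ 2 * R * ρ := by
      have := Nat.ceil_lt_add_one hRρ.le
      rw [← hm] at this
      linarith
    refine ⟨m, hm0, (div_le_one hm0').2 hm1, ?_⟩
    set σ := R * ρ / m with hσ
    have hσ0 : 0 < σ := by positivity
    have hσ1 : σ ≤ 1 := (div_le_one hm0').2 hm1
    have hσ2 : 1 / 2 ≤ σ := by
      rw [hσ, div_le_div_iff₀ (by norm_num) hm0']; linarith
    have hh1 := hpos 1 one_pos
    have hhσ := hpos σ hσ0
    have k1 : h 1 / 2 ≤ h σ / σ ^ ((n : ℝ) + α) := by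
      have a1 : σ / h σ ≤ 1 / h 1 := hmono' hσ0 (mem_Ioi.2 one_pos) hσ1
      rw [div_le_div_iff₀ hhσ hh1] at a1
      have a2 : h 1 / 2 ≤ h σ := by nlinarith
      have a3 : σ ^ ((n : ℝ) + α) ≤ 1 := Real.rpow_le_one hσ0.le hσ1 (by
        have := hα.1
        positivity)
      rw [le_div_iff₀ (Real.rpow_pos_of_pos hσ0 _)]
      nlinarith
    have k2 : ρ / (R * h 1) ≤ max (ρ ^ α) (ρ ^ 2) / h ρ := by
      refine le_trans ?_ (div_le_div_of_nonneg_right (le_max_right _ _) hhρ.le)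
      rw [div_le_div_iff₀ (by positivity) hhρ]
      rcases le_or_gt 1 ρ with h1 | h1
      · have a1 : 1 / h 1 ≤ ρ / h ρ := hmono' (mem_Ioi.2 one_pos) hρ h1
        rw [div_le_div_iff₀ hh1 hhρ] at a1
        have : h ρ ≤ ρ * (R * h 1) := by
          have : 0 ≤ (R - 1) * (ρ * h 1) := mul_nonneg (by linarith) (by positivity)
          nlinarith
        nlinarith
      · have a1 : h ρ ≤ h 1 := hmono hρ (mem_Ioi.2 one_pos) h1.le
        have : h ρ ≤ (R * ρ) * h 1 := by nlinarith
        nlinarith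
    calc (m : ℝ) ^ (n + 1) ≤ (2 * R * ρ) ^ (n + 1) := by gcongr
      _ = (2 * R) ^ (n + 2) * (ρ ^ n * (h 1 / 2)) * (ρ / (R * h 1)) := by
        rw [mul_pow, pow_succ (2 * R) (n + 1)]
        field_simp
        ring
      _ ≤ _ := by gcongr

lemma exists_R (n : ℕ) (hn : 2 ≤ n) : ∃ R : ℝ, 1 ≤ R ∧ ∀ ρ : ℝ, 0 < ρ →
    2 * ENNReal.ofReal (ρ ^ n) ≤
      volume (Metric.closedBall (0 : EuclideanSpace ℝ (Fin n)) (R * ρ)) := by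
  set β := volume (Metric.ball (0 : EuclideanSpace ℝ (Fin n)) 1) with hβ
  have hβ0 : 0 < β := Metric.measure_ball_pos _ _ one_pos
  have hβt : β ≠ ∞ := measure_ball_lt_top.ne
  have hb : 0 < β.toReal := ENNReal.toReal_pos hβ0.ne' hβt
  refine ⟨max 1 (2 / β.toReal), le_max_left _ _, fun ρ hρ => ?_⟩
  set R := max 1 (2 / β.toReal)
  have hR1 : 1 ≤ R := le_max_left _ _
  have hR2 : 2 ≤ R * β.toReal := by
    rw [← div_le_iff₀ hb]; exact le_max_right _ _
  rw [Measure.addHaar_closedBall _ _ (by positivity), ← hβ, finrank_euclideanSpace,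
    Fintype.card_fin, ← ENNReal.ofReal_toReal hβt, ← ENNReal.ofReal_mul (by positivity)]
  rw [show (2 : ℝ≥0∞) = ENNReal.ofReal 2 by simp, ← ENNReal.ofReal_mul (by norm_num)]
  apply ENNReal.ofReal_le_ofReal
  rw [mul_pow]
  have h1 : R ≤ R ^ n := le_self_pow₀ hR1 (by omega)
  have h2 : 2 ≤ R ^ n * β.toReal := hR2.trans (by gcongr)
  have h3 : 0 < ρ ^ n := by positivity
  nlinarith

lemma iso_ineq_s18 (n : ℕ) (hn : 2 ≤ n) (α : ℝ) (hα : α ∈ Ioo (0 : ℝ) 2)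
    (h : ℝ → ℝ) (hpos : ∀ s : ℝ, 0 < s → 0 < h s)
    (hmono : MonotoneOn h (Ioi (0 : ℝ)))
    (hmono' : MonotoneOn (fun s => s / h s) (Ioi (0 : ℝ))) :
    ∃ C : ℝ, 0 < C ∧ ∀ (A : Set (EuclideanSpace ℝ (Fin n))), MeasurableSet A →
      ∀ ρ : ℝ, 0 < ρ → volume A = ENNReal.ofReal (ρ ^ n) →
      1 ≤ ENNReal.ofReal C * (∫⁻ z, kerTrunc n α h z * omegaShift A z) *
        ENNReal.ofReal (max (ρ ^ α) (ρ ^ 2) / (ρ ^ n * h ρ)) := by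
  obtain ⟨R, hR, hvol⟩ := exists_R n hn
  refine ⟨(2 * R) ^ (n + 2), by positivity, fun A hA ρ hρ hv => ?_⟩
  obtain ⟨m, hm, hσ1, hreal⟩ := iso_real n α hα h hpos hmono hmono' R hR ρ hρ
  have hm' : (0 : ℝ) < m := by exact_mod_cast hm
  have hscaled := omegaShift_scaled hA (by rw [hv]; exact ENNReal.ofReal_ne_top) (R * ρ) m hm
    (by rw [hv]; exact hvol ρ hρ)
  set σ := R * ρ / m with hσ
  have hσ0 : 0 < σ := by positivity
  set k := h σ / σ ^ ((n : ℝ) + α) with hk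
  have hk0 : 0 < k := div_pos (hpos _ hσ0) (Real.rpow_pos_of_pos hσ0 _)
  have hker : ENNReal.ofReal k * ∫⁻ z in Metric.closedBall 0 σ, omegaShift A z ≤
      ∫⁻ z, kerTrunc n α h z * omegaShift A z := by
    rw [← lintegral_const_mul _ (measurable_omegaShift hA)]
    rw [← lintegral_indicator measurableSet_closedBall]
    refine lintegral_mono fun z => ?_
    by_cases hz : z ∈ Metric.closedBall (0 : EuclideanSpace ℝ (Fin n)) σ
    · rw [indicator_of_mem hz]
      rw [mem_closedBall_zero_iff] at hz
      rcases eq_or_ne z 0 with rfl | hz0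
      · simp [omegaShift_zero]
      · have hz0' : 0 < ‖z‖ := norm_pos_iff.2 hz0
        unfold kerTrunc
        rw [indicator_of_mem (show z ∈ {z : EuclideanSpace ℝ (Fin n) | 0 < ‖z‖ ∧ ‖z‖ ≤ 1} from
          ⟨hz0', hz.trans hσ1⟩)]
        gcongr
        exact ker_antitone n hn α hα h hpos hmono' hz0' hz
    · rw [indicator_of_notMem hz]; exact zero_le
  set P := ∫⁻ z, kerTrunc n α h z * omegaShift A z with hP
  have hMM : 0 < max (ρ ^ α) (ρ ^ 2) := lt_max_of_lt_right (by positivity)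
  set M := max (ρ ^ α) (ρ ^ 2) with hM
  have hhρ := hpos ρ hρ
  have hmE : (m : ℝ≥0∞) ^ (n + 1) = ENNReal.ofReal ((m : ℝ) ^ (n + 1)) := by
    rw [ENNReal.ofReal_pow hm'.le, ENNReal.ofReal_natCast]
  have step : ENNReal.ofReal (k * (ρ ^ n * ρ ^ n)) ≤ ENNReal.ofReal ((m : ℝ) ^ (n + 1)) * P := by
    calc ENNReal.ofReal (k * (ρ ^ n * ρ ^ n)) = ENNReal.ofReal k * (volume A * volume A) := by
          rw [hv, ENNReal.ofReal_mul hk0.le, ENNReal.ofReal_mul (by positivity)]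
      _ ≤ ENNReal.ofReal k * ((m : ℝ≥0∞) ^ (n + 1) *
          ∫⁻ z in Metric.closedBall 0 σ, omegaShift A z) := by gcongr
      _ = (m : ℝ≥0∞) ^ (n + 1) * (ENNReal.ofReal k *
          ∫⁻ z in Metric.closedBall 0 σ, omegaShift A z) := by ring
      _ ≤ (m : ℝ≥0∞) ^ (n + 1) * P := by gcongr
      _ = _ := by rw [hmE]
  have hmpos : 0 < ENNReal.ofReal ((m : ℝ) ^ (n + 1)) := ENNReal.ofReal_pos.2 (by positivity)
  have fin : ENNReal.ofReal ((m : ℝ) ^ (n + 1)) * 1 ≤ ENNReal.ofReal ((m : ℝ) ^ (n + 1)) *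
      (ENNReal.ofReal ((2 * R) ^ (n + 2)) * P * ENNReal.ofReal (M / (ρ ^ n * h ρ))) := by
    calc ENNReal.ofReal ((m : ℝ) ^ (n + 1)) * 1
        ≤ ENNReal.ofReal ((2 * R) ^ (n + 2) * (k * (ρ ^ n * ρ ^ n)) * (M / (ρ ^ n * h ρ))) := by
          rw [mul_one]
          apply ENNReal.ofReal_le_ofReal
          refine hreal.trans (le_of_eq ?_)
          field_simp
      _ = ENNReal.ofReal ((2 * R) ^ (n + 2)) * ENNReal.ofReal (k * (ρ ^ n * ρ ^ n)) *
          ENNReal.ofReal (M / (ρ ^ n * h ρ)) := by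
          rw [ENNReal.ofReal_mul (by positivity), ENNReal.ofReal_mul (by positivity)]
      _ ≤ ENNReal.ofReal ((2 * R) ^ (n + 2)) * (ENNReal.ofReal ((m : ℝ) ^ (n + 1)) * P) *
          ENNReal.ofReal (M / (ρ ^ n * h ρ)) := by gcongr
      _ = _ := by ring
  exact (ENNReal.mul_le_mul_iff_right hmpos.ne' ENNReal.ofReal_ne_top).1 fin

lemma swap3 {X Y Z : Type*} [MeasurableSpace X] [MeasurableSpace Y] [MeasurableSpace Z]
    (μ : Measure X) (ν : Measure Y) (τ : Measure Z) [SFinite μ] [SFinite ν] [SFinite τ]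
    (G : X → Y → Z → ℝ≥0∞) (hG : Measurable (fun q : (X × Y) × Z => G q.1.1 q.1.2 q.2)) :
    ∫⁻ s, ∫⁻ z, ∫⁻ x, G s z x ∂τ ∂ν ∂μ = ∫⁻ x, ∫⁻ z, ∫⁻ s, G s z x ∂μ ∂ν ∂τ := by
  have sw1 : ∀ s : X, ∫⁻ z, ∫⁻ x, G s z x ∂τ ∂ν = ∫⁻ x, ∫⁻ z, G s z x ∂ν ∂τ := by
    intro s
    refine lintegral_lintegral_swap ?_
    have : Measurable (fun q : Y × Z => ((s, q.1), q.2)) := by fun_prop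
    exact (hG.comp this).aemeasurable
  simp_rw [sw1]
  rw [lintegral_lintegral_swap]
  swap
  · have h1 : Measurable (fun q : (X × Z) × Y => G q.1.1 q.2 q.1.2) := by
      have : Measurable (fun q : (X × Z) × Y => ((q.1.1, q.2), q.1.2)) := by fun_prop
      exact hG.comp this
    exact h1.lintegral_prod_right'.aemeasurable
  congr 1
  funext x
  rw [lintegral_lintegral_swap]
  have : Measurable (fun q : X × Y => (q, x)) := by fun_prop
  exact (hG.comp this).aemeasurable

lemma measurableSet_level3 {n : ℕ} (f : EuclideanSpace ℝ (Fin n) → ℝ) (hf : Measurable f) :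
    MeasurableSet {q : (ℝ × EuclideanSpace ℝ (Fin n)) × EuclideanSpace ℝ (Fin n) |
      q.1.1 < ‖f q.2‖ ∧ ¬ q.1.1 < ‖f (q.2 + q.1.2)‖} := by
  have h1 : Measurable (fun q : (ℝ × EuclideanSpace ℝ (Fin n)) × EuclideanSpace ℝ (Fin n) =>
    ‖f q.2‖) := by fun_prop
  have h2 : Measurable (fun q : (ℝ × EuclideanSpace ℝ (Fin n)) × EuclideanSpace ℝ (Fin n) =>
    ‖f (q.2 + q.1.2)‖) := by fun_prop
  have h3 : Measurable (fun q : (ℝ × EuclideanSpace ℝ (Fin n)) × EuclideanSpace ℝ (Fin n) =>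
    q.1.1) := by fun_prop
  exact (measurableSet_lt h3 h1).inter (measurableSet_lt h3 h2).compl

lemma coarea_le_s18 (n : ℕ) (α : ℝ)
    (h : ℝ → ℝ) (hpos : ∀ s : ℝ, 0 < s → 0 < h s)
    (hmono : MonotoneOn h (Ioi (0 : ℝ)))
    (f : EuclideanSpace ℝ (Fin n) → ℝ) (hf : Measurable f) :
    ∫⁻ s in Ioi (0 : ℝ), ∫⁻ z, kerTrunc n α h z * omegaShift {x | s < ‖f x‖} z ≤
      ∫⁻ x, (∫⁻ y in Metric.closedBall x 1, (‖f x - f y‖₊ : ℝ≥0∞) *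
            ENNReal.ofReal (h (dist x y) / dist x y ^ ((n : ℝ) + α))) := by
  have hK := measurable_kerTrunc n α h hpos hmono
  have hS3 : MeasurableSet {q : (ℝ × EuclideanSpace ℝ (Fin n)) × EuclideanSpace ℝ (Fin n) |
      q.1.1 < ‖f q.2‖ ∧ ¬ q.1.1 < ‖f (q.2 + q.1.2)‖} := measurableSet_level3 f hf
  set G : ℝ → EuclideanSpace ℝ (Fin n) → EuclideanSpace ℝ (Fin n) → ℝ≥0∞ :=
    fun s z x => kerTrunc n α h z *
      {x | s < ‖f x‖ ∧ ¬ s < ‖f (x + z)‖}.indicator (fun _ => (1 : ℝ≥0∞)) x with hG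
  have hGm : Measurable (fun q : (ℝ × EuclideanSpace ℝ (Fin n)) × EuclideanSpace ℝ (Fin n) =>
      G q.1.1 q.1.2 q.2) := by
    refine Measurable.mul (hK.comp (measurable_snd.comp measurable_fst)) ?_
    exact (measurable_const (a := (1 : ℝ≥0∞))).indicator hS3
  have e1 : ∀ s z, kerTrunc n α h z * omegaShift {x | s < ‖f x‖} z = ∫⁻ x, G s z x := by
    intro s z
    have hSm : MeasurableSet {x | s < ‖f x‖ ∧ ¬ s < ‖f (x + z)‖} := by
      have : Measurable (fun x : EuclideanSpace ℝ (Fin n) => ((s, z), x)) := by fun_prop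
      exact this (measurableSet_level3 f hf)
    rw [hG]
    simp only
    rw [lintegral_const_mul _ (measurable_const.indicator hSm), lintegral_indicator hSm,
      setLIntegral_const, one_mul]
    rfl
  simp_rw [e1]
  rw [swap3 _ _ _ G hGm]
  refine lintegral_mono fun x => ?_
  rw [← lintegral_indicator measurableSet_closedBall]
  refine le_trans ?_ (lintegral_add_left_eq_self _ x).le
  refine lintegral_mono fun z => ?_
  have hz1 : ∫⁻ s in Ioi (0 : ℝ), G s z x ≤ kerTrunc n α h z * (‖f x - f (x + z)‖₊ : ℝ≥0∞) := by
    rw [hG]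
    simp only
    have hSm : MeasurableSet {s : ℝ | s < ‖f x‖ ∧ ¬ s < ‖f (x + z)‖} := by
      have : Measurable (fun s : ℝ => ((s, z), x)) := by fun_prop
      exact this (measurableSet_level3 f hf)
    have e2 : ∀ s : ℝ, {x | s < ‖f x‖ ∧ ¬ s < ‖f (x + z)‖}.indicator (fun _ => (1 : ℝ≥0∞)) x =
      {s : ℝ | s < ‖f x‖ ∧ ¬ s < ‖f (x + z)‖}.indicator (fun _ => (1 : ℝ≥0∞)) s := fun s => rfl
    simp_rw [e2]
    rw [lintegral_const_mul _ (measurable_const.indicator hSm)]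
    gcongr
    refine (setLIntegral_le_lintegral _ _).trans ?_
    rw [lintegral_indicator hSm, setLIntegral_const, one_mul]
    calc volume {s : ℝ | s < ‖f x‖ ∧ ¬ s < ‖f (x + z)‖}
        ≤ volume (Ico ‖f (x + z)‖ ‖f x‖) := measure_mono fun s hs => ⟨not_lt.1 hs.2, hs.1⟩
      _ = ENNReal.ofReal (‖f x‖ - ‖f (x + z)‖) := Real.volume_Ico
      _ ≤ ENNReal.ofReal ‖f x - f (x + z)‖ := ENNReal.ofReal_le_ofReal (norm_sub_norm_le _ _)
      _ = _ := by rw [ofReal_norm]; rfl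
  refine hz1.trans ?_
  unfold kerTrunc
  by_cases hz : z ∈ {z : EuclideanSpace ℝ (Fin n) | 0 < ‖z‖ ∧ ‖z‖ ≤ 1}
  · rw [indicator_of_mem hz, indicator_of_mem (by
      rw [Metric.mem_closedBall, dist_eq_norm]; simpa using hz.2)]
    have : dist x (x + z) = ‖z‖ := by simp [dist_eq_norm]
    rw [this, mul_comm]
  · rw [indicator_of_notMem hz, zero_mul]
    exact zero_le

lemma main_abstract (n : ℕ) (hn : 2 ≤ n) (α : ℝ) (hα : α ∈ Ioo (0 : ℝ) 2)
    (h : ℝ → ℝ) (hpos : ∀ s : ℝ, 0 < s → 0 < h s)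
    (hmono : MonotoneOn h (Ioi (0 : ℝ)))
    (hmono' : MonotoneOn (fun s => s / h s) (Ioi (0 : ℝ)))
    (Φ : ℝ → ℝ≥0∞) (N : ℝ≥0 → ℝ≥0∞) (D : ℝ) (hD : 0 < D)
    (hΦ0 : Φ 0 = 0)
    (hline : ∀ u : ℝ, 0 < u → ∃ c : ℝ≥0, ∀ t : ℝ, 0 ≤ t →
      Φ t + c * ENNReal.ofReal u ≤ Φ u + c * ENNReal.ofReal t)
    (hlow : ∀ ρ : ℝ, 0 < ρ → ENNReal.ofReal (max (ρ ^ α) (ρ ^ 2) / (ρ ^ n * h ρ)) ≤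
      ENNReal.ofReal D * Φ ((ρ ^ n)⁻¹))
    (hNpos : ∀ s, 0 < s → 0 < N s) (hNm : Monotone N)
    (hinv : ∀ (u : ℝ) (s : ℝ≥0), 0 < u → (s : ℝ≥0∞) ≤ Φ u → N s ≤ ENNReal.ofReal u) :
    (∃ C : ℝ, 0 < C ∧
      ∀ f : EuclideanSpace ℝ (Fin n) → ℝ, Measurable f →
        orliczNorm volume N f < ∞ →
        orliczNorm volume N f ≤ ENNReal.ofReal C *
          ∫⁻ x, (∫⁻ y in Metric.closedBall x 1, (‖f x - f y‖₊ : ℝ≥0∞) *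
            ENNReal.ofReal (h (dist x y) / dist x y ^ ((n : ℝ) + α)))) := by
  obtain ⟨C, hC, hiso⟩ := iso_ineq_s18 n hn α hα h hpos hmono hmono'
  refine ⟨C * D, by positivity, fun f hf hfin => ?_⟩
  refine le_trans ?_ (mul_le_mul_right (coarea_le_s18 n α h hpos hmono f hf) _)
  set p : ℝ → ℝ≥0∞ := fun s => ∫⁻ z, kerTrunc n α h z * omegaShift {x | s < ‖f x‖} z with hp
  set v : ℝ → ℝ≥0∞ := fun s => volume {x | s < ‖f x‖} with hv
  have hlev : ∀ s, MeasurableSet {x | s < ‖f x‖} := fun s =>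
    measurableSet_lt measurable_const hf.norm
  have hK := measurable_kerTrunc n α h hpos hmono
  have hvm : Measurable v := by
    refine Antitone.measurable ?_
    intro a b hab
    exact measure_mono fun x hx => lt_of_le_of_lt hab hx
  have hpm : Measurable p := by
    have hS3 : MeasurableSet {q : (ℝ × EuclideanSpace ℝ (Fin n)) × EuclideanSpace ℝ (Fin n) |
        q.1.1 < ‖f q.2‖ ∧ ¬ q.1.1 < ‖f (q.2 + q.1.2)‖} := measurableSet_level3 f hf
    have h1 : Measurable (fun q : ℝ × EuclideanSpace ℝ (Fin n) =>
        omegaShift {x | q.1 < ‖f x‖} q.2) := measurable_measure_prodMk_left hS3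
    exact ((hK.comp measurable_snd).mul h1).lintegral_prod_right'
  have hvfin : ∀ s, 0 < s → v s ≠ ∞ := by
    intro s hs
    unfold orliczNorm at hfin
    obtain ⟨r, hr⟩ := iInf_lt_iff.1 hfin
    obtain ⟨⟨hr0, hr1⟩, -⟩ := iInf_lt_iff.1 hr
    have hm1 : Measurable (fun x => N (‖f x‖₊ / r)) :=
      hNm.measurable.comp (hf.nnnorm.div_const r)
    obtain ⟨s', hs'e⟩ : ∃ s' : ℝ≥0, (s' : ℝ) = s := ⟨⟨s, hs.le⟩, rfl⟩
    have hs'0 : 0 < s' := by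
      rw [← NNReal.coe_pos, hs'e]; exact hs
    have hs' : 0 < s' / r := div_pos hs'0 hr0
    have h1 := mul_meas_ge_le_lintegral (μ := volume) hm1 (N (s' / r))
    have h2 : v s ≤ volume {x | N (s' / r) ≤ N (‖f x‖₊ / r)} := by
      refine measure_mono fun x hx => hNm ?_
      have : s' ≤ ‖f x‖₊ := by
        rw [← NNReal.coe_le_coe, hs'e]
        exact (le_of_lt hx : s ≤ ‖f x‖)
      gcongr
    intro htop
    rw [htop, top_le_iff] at h2
    rw [h2, ENNReal.mul_top (hNpos _ hs').ne'] at h1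
    exact absurd (h1.trans hr1) (by simp)
  have hisoS : ∀ s, 0 < s → v s ≠ 0 →
      1 ≤ ENNReal.ofReal (C * D) * p s * Φ ((v s).toReal⁻¹) := by
    intro s hs hs0
    have hvp : 0 < (v s).toReal := ENNReal.toReal_pos hs0 (hvfin s hs)
    set ρ := (v s).toReal ^ ((n : ℝ)⁻¹) with hρ
    have hρ0 : 0 < ρ := Real.rpow_pos_of_pos hvp _
    have hρn : ρ ^ n = (v s).toReal := Real.rpow_inv_natCast_pow hvp.le (by omega)
    have h1 := hiso {x | s < ‖f x‖} (hlev s) ρ hρ0 (by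
      rw [hρn, ENNReal.ofReal_toReal (hvfin s hs)])
    have h2 := hlow ρ hρ0
    rw [hρn] at h1 h2
    calc 1 ≤ _ := h1
      _ ≤ ENNReal.ofReal C * p s * (ENNReal.ofReal D * Φ ((v s).toReal⁻¹)) := by gcongr
      _ = _ := by rw [ENNReal.ofReal_mul hC.le]; ring
  set K := ENNReal.ofReal (C * D) with hKdef
  refine le_of_forall_gt fun b hb => ?_
  obtain ⟨r, hr1, hr2⟩ := ENNReal.lt_iff_exists_nnreal_btwn.1 hb
  have hr0 : 0 < r := by
    have : (0 : ℝ≥0∞) < r := lt_of_le_of_lt zero_le hr1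
    exact_mod_cast this
  have hrE : (r : ℝ≥0∞) ≠ 0 := by exact_mod_cast hr0.ne'
  refine lt_of_le_of_lt ?_ hr2
  refine iInf_le_of_le r (iInf_le_of_le ⟨hr0, ?_⟩ le_rfl)
  set q : ℝ → ℝ≥0∞ := fun s => K * p s / r with hq
  have hqm : Measurable q := (hpm.const_mul K).div_const _
  have hqint : ∫⁻ s in Ioi (0 : ℝ), q s ≤ 1 := by
    have : ∫⁻ s in Ioi (0 : ℝ), q s = K * (∫⁻ s in Ioi (0 : ℝ), p s) / r := by
      simp only [hq, div_eq_mul_inv]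
      rw [lintegral_mul_const _ (hpm.const_mul K), lintegral_const_mul _ hpm]
    rw [this]
    exact ENNReal.div_le_of_le_mul (by rw [one_mul]; exact hr1.le)
  set U : EuclideanSpace ℝ (Fin n) → ℝ≥0∞ :=
    fun x => ∫⁻ s in Ioi (0 : ℝ), {x | s < ‖f x‖}.indicator (fun _ => q s * (v s)⁻¹) x with hU
  have hIm : Measurable (fun w : EuclideanSpace ℝ (Fin n) × ℝ =>
      {x | w.2 < ‖f x‖}.indicator (fun _ => q w.2 * (v w.2)⁻¹) w.1) := by
    have hS : MeasurableSet {w : EuclideanSpace ℝ (Fin n) × ℝ | w.2 < ‖f w.1‖} :=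
      measurableSet_lt (by fun_prop) (by fun_prop)
    have hg : Measurable (fun w : EuclideanSpace ℝ (Fin n) × ℝ => q w.2 * (v w.2)⁻¹) :=
      (hqm.mul hvm.inv).comp measurable_snd
    exact hg.indicator hS
  have hUm : Measurable U := hIm.lintegral_prod_right'
  have hUint : ∫⁻ x, U x ≤ 1 := by
    rw [hU, lintegral_lintegral_swap hIm.aemeasurable]
    refine le_trans ?_ hqint
    refine setLIntegral_mono' measurableSet_Ioi fun s hs => ?_
    rw [lintegral_indicator (hlev s), setLIntegral_const, mul_assoc]
    exact mul_le_of_le_one_right' (ENNReal.inv_mul_le_one _)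
  refine le_trans (lintegral_mono_ae ?_) hUint
  have hUfin : ∀ᵐ x, U x < ∞ := ae_lt_top hUm (hUint.trans_lt ENNReal.one_lt_top).ne
  have hgood : ∀ᵐ x, ∀ s, 0 < s → s < ‖f x‖ → v s ≠ 0 := by
    have h1 : ∀ a : ℚ, ∀ᵐ x, v a = 0 → ¬ ((a : ℝ) < ‖f x‖) := by
      intro a
      by_cases ha : v a = 0
      · have : ∀ᵐ x, ¬ ((a : ℝ) < ‖f x‖) := by
          rw [ae_iff]
          simp only [not_not]
          exact ha
        filter_upwards [this] with x hx _ using hx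
      · exact Eventually.of_forall fun x h0 => absurd h0 ha
    filter_upwards [ae_all_iff.2 h1] with x hx s hs hsx hs0
    obtain ⟨a, ha1, ha2⟩ := exists_rat_btwn hsx
    refine hx a ?_ ha2
    exact le_antisymm ((measure_mono fun y hy => lt_trans ha1 hy).trans hs0.le) zero_le
  filter_upwards [hUfin, hgood] with x hxU hxg
  refine le_of_forall_gt fun b' hb' => ?_
  obtain ⟨u', hu1, hu2⟩ := ENNReal.lt_iff_exists_nnreal_btwn.1 hb'
  refine lt_of_le_of_lt ?_ hu2
  have hu0 : 0 < (u' : ℝ) := by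
    have : (0 : ℝ≥0∞) < u' := lt_of_le_of_lt zero_le hu1
    exact_mod_cast this
  rw [← ENNReal.ofReal_coe_nnreal]
  refine hinv _ _ hu0 ?_
  obtain ⟨c, hc⟩ := hline u' hu0
  rw [ENNReal.ofReal_coe_nnreal] at hc
  have hc0 : (c : ℝ≥0∞) * u' ≤ Φ u' := by
    have := hc 0 le_rfl
    simpa [hΦ0] using this
  set I := Ioo (0 : ℝ) ‖f x‖ with hI
  have hUx : U x = ∫⁻ s in I, q s * (v s)⁻¹ := by
    have e : ∀ s : ℝ, {x | s < ‖f x‖}.indicator (fun _ => q s * (v s)⁻¹) x =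
      (Iio ‖f x‖).indicator (fun s => q s * (v s)⁻¹) s := fun s => rfl
    rw [hU]
    simp only [e]
    rw [lintegral_indicator measurableSet_Iio, Measure.restrict_restrict measurableSet_Iio,
      inter_comm, Ioi_inter_Iio]
  set m := ∫⁻ s in I, q s with hm
  have hm1 : m ≤ 1 := (lintegral_mono_set (fun s hs => hs.1)).trans hqint
  have hJ : (‖f x‖₊ : ℝ≥0∞) / r ≤ ∫⁻ s in I, Φ ((v s).toReal⁻¹) * q s := by
    calc (‖f x‖₊ : ℝ≥0∞) / r = ∫⁻ s in I, (r : ℝ≥0∞)⁻¹ := by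
          rw [setLIntegral_const, hI, Real.volume_Ioo, sub_zero, ofReal_norm,
            div_eq_mul_inv, mul_comm]
          rfl
      _ ≤ _ := by
          refine setLIntegral_mono' measurableSet_Ioo fun s hs => ?_
          have := hisoS s hs.1 (hxg s hs.1 hs.2)
          calc (r : ℝ≥0∞)⁻¹ = 1 * (r : ℝ≥0∞)⁻¹ := (one_mul _).symm
            _ ≤ (K * p s * Φ ((v s).toReal⁻¹)) * (r : ℝ≥0∞)⁻¹ := by gcongr
            _ = _ := by simp only [hq, div_eq_mul_inv]; ring
  have hqv : Measurable (fun s => q s * (v s)⁻¹) := hqm.mul hvm.inv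
  have hint : (∫⁻ s in I, Φ ((v s).toReal⁻¹) * q s) + c * u' * m ≤ Φ u' * m + c * u' := by
    calc (∫⁻ s in I, Φ ((v s).toReal⁻¹) * q s) + c * u' * m
        = ∫⁻ s in I, (Φ ((v s).toReal⁻¹) * q s + c * u' * q s) := by
          rw [lintegral_add_right _ (hqm.const_mul _), lintegral_const_mul _ hqm]
      _ ≤ ∫⁻ s in I, (Φ u' * q s + c * (q s * (v s)⁻¹)) := by
          refine setLIntegral_mono' measurableSet_Ioo fun s hs => ?_
          have h1 := hc ((v s).toReal⁻¹) (by positivity)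
          have h0 := hxg s hs.1 hs.2
          have h2 : ENNReal.ofReal ((v s).toReal⁻¹) = (v s)⁻¹ := by
            rw [ENNReal.ofReal_inv_of_pos (ENNReal.toReal_pos h0 (hvfin s hs.1)),
              ENNReal.ofReal_toReal (hvfin s hs.1)]
          rw [h2] at h1
          calc _ = (Φ ((v s).toReal⁻¹) + c * u') * q s := by ring
            _ ≤ (Φ u' + c * (v s)⁻¹) * q s := by gcongr
            _ = _ := by ring
      _ = Φ u' * m + c * U x := by
          rw [lintegral_add_left (hqm.const_mul _), lintegral_const_mul _ hqm,
            lintegral_const_mul _ hqv, hUx]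
      _ ≤ _ := by gcongr
  have hfinal : (∫⁻ s in I, Φ ((v s).toReal⁻¹) * q s) + c * u' ≤ Φ u' + c * u' := by
    have hmm : m + (1 - m) = 1 := add_tsub_cancel_of_le hm1
    calc (∫⁻ s in I, Φ ((v s).toReal⁻¹) * q s) + c * u'
        = (∫⁻ s in I, Φ ((v s).toReal⁻¹) * q s) + c * u' * (m + (1 - m)) := by
          rw [hmm, mul_one]
      _ = ((∫⁻ s in I, Φ ((v s).toReal⁻¹) * q s) + c * u' * m) + c * u' * (1 - m) := by ring
      _ ≤ (Φ u' * m + c * u') + Φ u' * (1 - m) := by gcongr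
      _ = Φ u' * (m + (1 - m)) + c * u' := by ring
      _ = _ := by rw [hmm, mul_one]
  rw [ENNReal.coe_div hr0.ne']
  refine hJ.trans ?_
  exact (ENNReal.add_le_add_iff_right (ENNReal.mul_ne_top ENNReal.coe_ne_top
    ENNReal.coe_ne_top)).1 hfinal

/-- the density of `PhiTilde` -/
def phiT (n : ℕ) (α : ℝ) (h : ℝ → ℝ) (t : ℝ) : ℝ≥0∞ :=
  ∫⁻ r in Ioo (0 : ℝ) (max (t ^ (-(α / (n : ℝ)))) (t ^ (-(2 / (n : ℝ))))),
      ENNReal.ofReal (1 / h (min (r ^ α⁻¹) (r ^ ((1 : ℝ) / 2))))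

lemma PhiTilde_eq (n : ℕ) (α : ℝ) (h : ℝ → ℝ) (s : ℝ) :
    PhiTilde n α h s = ∫⁻ t in Ioo (0 : ℝ) s, phiT n α h t := rfl

lemma phiT_anti (n : ℕ) (α : ℝ) (hα : α ∈ Ioo (0 : ℝ) 2) (h : ℝ → ℝ) {a b : ℝ} (ha : 0 < a)
    (hab : a ≤ b) : phiT n α h b ≤ phiT n α h a := by
  unfold phiT
  refine lintegral_mono_set (Ioo_subset_Ioo_right (max_le_max ?_ ?_))
  · refine Real.rpow_le_rpow_of_nonpos ha hab ?_
    have := hα.1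
    have : 0 ≤ α / (n : ℝ) := by positivity
    linarith
  · refine Real.rpow_le_rpow_of_nonpos ha hab ?_
    have : 0 ≤ 2 / (n : ℝ) := by positivity
    linarith

lemma PhiTilde_zero (n : ℕ) (α : ℝ) (h : ℝ → ℝ) : PhiTilde n α h 0 = 0 := by
  simp [PhiTilde]

lemma PhiTilde_split (n : ℕ) (α : ℝ) (h : ℝ → ℝ) {a b : ℝ} (ha : 0 ≤ a) (hab : a ≤ b) :
    PhiTilde n α h b = PhiTilde n α h a + ∫⁻ t in Ico a b, phiT n α h t := by
  rcases ha.eq_or_lt with rfl | ha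
  · rw [PhiTilde_zero, zero_add, PhiTilde_eq]
    exact setLIntegral_congr Ioo_ae_eq_Ico
  · rw [PhiTilde_eq, PhiTilde_eq, ← lintegral_union measurableSet_Ico, Ioo_union_Ico_eq_Ioo ha hab]
    rw [Set.disjoint_left]
    intro x hx hx'
    exact absurd hx.2 (not_lt.2 hx'.1)

lemma PhiTilde_ge (n : ℕ) (α : ℝ) (hα : α ∈ Ioo (0 : ℝ) 2) (h : ℝ → ℝ) {u t : ℝ}
    (ht : 0 ≤ t) (htu : t ≤ u) :
    PhiTilde n α h t + phiT n α h u * ENNReal.ofReal (u - t) ≤ PhiTilde n α h u := by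
  rw [PhiTilde_split n α h ht htu]
  gcongr
  have e : ∫⁻ s in Ico t u, phiT n α h s = ∫⁻ s in Ioo t u, phiT n α h s :=
    (setLIntegral_congr Ioo_ae_eq_Ico).symm
  rw [e, ← Real.volume_Ioo, ← setLIntegral_const]
  exact setLIntegral_mono' measurableSet_Ioo fun s hs =>
    phiT_anti n α hα h (ht.trans_lt hs.1) hs.2.le

lemma PhiTilde_le (n : ℕ) (α : ℝ) (hα : α ∈ Ioo (0 : ℝ) 2) (h : ℝ → ℝ) {u t : ℝ}
    (hu : 0 < u) (htu : u ≤ t) :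
    PhiTilde n α h t ≤ PhiTilde n α h u + phiT n α h u * ENNReal.ofReal (t - u) := by
  rw [PhiTilde_split n α h hu.le htu]
  gcongr
  rw [← Real.volume_Ico, ← setLIntegral_const]
  exact setLIntegral_mono' measurableSet_Ico fun s hs => phiT_anti n α hα h hu hs.1

lemma phiT_mul_le (n : ℕ) (α : ℝ) (hα : α ∈ Ioo (0 : ℝ) 2) (h : ℝ → ℝ) {u : ℝ}
    (hu : 0 < u) : phiT n α h u * ENNReal.ofReal u ≤ PhiTilde n α h u := by
  have := PhiTilde_ge n α hα h le_rfl hu.le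
  simpa [PhiTilde_zero] using this

lemma PhiTilde_line (n : ℕ) (α : ℝ) (hα : α ∈ Ioo (0 : ℝ) 2) (h : ℝ → ℝ)
    (hΦ : ∀ s : ℝ, 0 < s → PhiTilde n α h s < ∞) (u : ℝ) (hu : 0 < u) :
    ∃ c : ℝ≥0, ∀ t : ℝ, 0 ≤ t →
      PhiTilde n α h t + c * ENNReal.ofReal u ≤ PhiTilde n α h u + c * ENNReal.ofReal t := by
  have hfin : phiT n α h u ≠ ∞ := by
    intro htop
    have h1 := phiT_mul_le n α hα h hu
    rw [htop, ENNReal.top_mul (ENNReal.ofReal_pos.2 hu).ne'] at h1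
    exact absurd (h1.trans_lt (hΦ u hu)) (lt_irrefl _)
  refine ⟨(phiT n α h u).toNNReal, fun t ht => ?_⟩
  rw [ENNReal.coe_toNNReal hfin]
  rcases le_total t u with htu | htu
  · calc PhiTilde n α h t + phiT n α h u * ENNReal.ofReal u
        = PhiTilde n α h t + phiT n α h u * ENNReal.ofReal (u - t) +
            phiT n α h u * ENNReal.ofReal t := by
          rw [add_assoc, ← mul_add, ← ENNReal.ofReal_add (by linarith) ht, sub_add_cancel]
      _ ≤ _ := by gcongr; exact PhiTilde_ge n α hα h ht htu
  · calc PhiTilde n α h t + phiT n α h u * ENNReal.ofReal u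
        ≤ PhiTilde n α h u + phiT n α h u * ENNReal.ofReal (t - u) +
            phiT n α h u * ENNReal.ofReal u := by
          gcongr; exact PhiTilde_le n α hα h hu htu
      _ = _ := by
          rw [add_assoc, ← mul_add, ← ENNReal.ofReal_add (by linarith) hu.le, sub_add_cancel]

lemma PhiTilde_low (n : ℕ) (hn : 2 ≤ n) (α : ℝ) (hα : α ∈ Ioo (0 : ℝ) 2) (h : ℝ → ℝ)
    (hpos : ∀ s : ℝ, 0 < s → 0 < h s)
    (hmono : MonotoneOn h (Ioi (0 : ℝ))) (ρ : ℝ) (hρ : 0 < ρ) :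
    ENNReal.ofReal (max (ρ ^ α) (ρ ^ 2) / (ρ ^ n * h ρ)) ≤ PhiTilde n α h ((ρ ^ n)⁻¹) := by
  have hn0 : (n : ℝ) ≠ 0 := by
    have : n ≠ 0 := by omega
    exact_mod_cast this
  have hα0 := hα.1
  have hv : 0 < ρ ^ n := by positivity
  refine le_trans ?_ (phiT_mul_le n α hα h (inv_pos.2 hv))
  have e : ∀ b : ℝ, ((ρ ^ n)⁻¹) ^ (-(b / (n : ℝ))) = ρ ^ b := by
    intro b
    rw [Real.inv_rpow hv.le, Real.rpow_neg hv.le, inv_inv, ← Real.rpow_natCast,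
      ← Real.rpow_mul hρ.le]
    congr 1
    field_simp
  have e2 : ρ ^ (2 : ℝ) = ρ ^ 2 := by exact_mod_cast Real.rpow_natCast ρ 2
  have hhρ := hpos ρ hρ
  have key : ENNReal.ofReal (1 / h ρ) * ENNReal.ofReal (max (ρ ^ α) (ρ ^ 2)) ≤
      phiT n α h ((ρ ^ n)⁻¹) := by
    unfold phiT
    rw [e, e, e2]
    have : ENNReal.ofReal (max (ρ ^ α) (ρ ^ 2)) = volume (Ioo 0 (max (ρ ^ α) (ρ ^ 2))) := by
      rw [Real.volume_Ioo, sub_zero]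
    rw [this, ← setLIntegral_const]
    refine setLIntegral_mono' measurableSet_Ioo fun r hr => ?_
    apply ENNReal.ofReal_le_ofReal
    have hr0 : 0 < r := hr.1
    have p0 : 0 < min (r ^ α⁻¹) (r ^ ((1 : ℝ) / 2)) :=
      lt_min (Real.rpow_pos_of_pos hr0 _) (Real.rpow_pos_of_pos hr0 _)
    have p1 : min (r ^ α⁻¹) (r ^ ((1 : ℝ) / 2)) ≤ ρ := by
      rcases lt_max_iff.1 hr.2 with h1 | h1
      · refine (min_le_left _ _).trans ?_
        calc r ^ α⁻¹ ≤ (ρ ^ α) ^ α⁻¹ := Real.rpow_le_rpow hr0.le h1.le (by positivity)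
          _ = ρ := Real.rpow_rpow_inv hρ.le hα0.ne'
      · refine (min_le_right _ _).trans ?_
        calc r ^ ((1 : ℝ) / 2) ≤ (ρ ^ 2) ^ ((1 : ℝ) / 2) :=
              Real.rpow_le_rpow hr0.le h1.le (by positivity)
          _ = ρ := by rw [← Real.sqrt_eq_rpow, Real.sqrt_sq hρ.le]
    exact one_div_le_one_div_of_le (hpos _ p0) (hmono p0 hρ p1)
  calc ENNReal.ofReal (max (ρ ^ α) (ρ ^ 2) / (ρ ^ n * h ρ))
      = ENNReal.ofReal (1 / h ρ) * ENNReal.ofReal (max (ρ ^ α) (ρ ^ 2)) *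
          ENNReal.ofReal ((ρ ^ n)⁻¹) := by
        rw [← ENNReal.ofReal_mul (by positivity), ← ENNReal.ofReal_mul (by positivity)]
        congr 1
        field_simp
    _ ≤ _ := by gcongr

lemma NhTilde_pos (n : ℕ) (α : ℝ) (h : ℝ → ℝ)
    (hΦ : ∀ s : ℝ, 0 < s → PhiTilde n α h s < ∞) (s : ℝ≥0) (hs : 0 < s) :
    0 < NhTilde n α h s := by
  have hs' : (s : ℝ≥0∞) ≠ 0 := by exact_mod_cast hs.ne'
  have h1 := hΦ 1 one_pos
  rw [PhiTilde_eq] at h1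
  obtain ⟨δ, hδ, hδ'⟩ := exists_pos_setLIntegral_lt_of_measure_lt h1.ne hs'
  obtain ⟨d, hd0, hd1⟩ := ENNReal.lt_iff_exists_nnreal_btwn.1 hδ
  have hd0' : (0 : ℝ) < d := by exact_mod_cast hd0
  set w : ℝ := min d 1 with hw
  have hw0 : 0 < w := lt_min hd0' one_pos
  have hsmall : PhiTilde n α h w < s := by
    have h2 := hδ' (Ioo 0 w) (by
      refine lt_of_le_of_lt ?_ hd1
      refine (Measure.restrict_apply_le _ _).trans ?_
      rw [Real.volume_Ioo, sub_zero, ← ENNReal.ofReal_coe_nnreal]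
      exact ENNReal.ofReal_le_ofReal (min_le_left _ _))
    rw [Measure.restrict_restrict measurableSet_Ioo, inter_eq_left.2
      (Ioo_subset_Ioo_right (min_le_right _ _))] at h2
    exact h2
  refine lt_of_lt_of_le (ENNReal.ofReal_pos.2 hw0) ?_
  unfold NhTilde
  refine le_iInf₂ fun u hu => ENNReal.ofReal_le_ofReal ?_
  by_contra hlt
  push Not at hlt
  have : PhiTilde n α h u ≤ PhiTilde n α h w := by
    rw [PhiTilde_eq, PhiTilde_eq]
    exact lintegral_mono_set (Ioo_subset_Ioo_right hlt.le)
  exact absurd (hu.2.trans this) (not_le.2 hsmall)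

lemma NhTilde_mono (n : ℕ) (α : ℝ) (h : ℝ → ℝ) : Monotone (NhTilde n α h) := by
  intro a b hab
  unfold NhTilde
  refine le_iInf₂ fun u hu => iInf₂_le u ⟨hu.1, le_trans ?_ hu.2⟩
  exact_mod_cast hab

lemma NhTilde_zero (n : ℕ) (α : ℝ) (h : ℝ → ℝ) : NhTilde n α h 0 = 0 := by
  refine le_antisymm ?_ zero_le
  refine le_of_forall_gt fun b hb => ?_
  obtain ⟨d, hd0, hd1⟩ := ENNReal.lt_iff_exists_nnreal_btwn.1 hb
  refine lt_of_le_of_lt ?_ hd1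
  rw [← ENNReal.ofReal_coe_nnreal]
  exact iInf₂_le (d : ℝ) ⟨by exact_mod_cast hd0, by simp⟩

lemma NhTilde_convex (n : ℕ) (α : ℝ) (hα : α ∈ Ioo (0 : ℝ) 2) (h : ℝ → ℝ)
    (hΦ : ∀ s : ℝ, 0 < s → PhiTilde n α h s < ∞) (a b t : ℝ≥0) (ht : t ≤ 1) :
    NhTilde n α h (t * a + (1 - t) * b) ≤
      (t : ℝ≥0∞) * NhTilde n α h a + ((1 - t : ℝ≥0) : ℝ≥0∞) * NhTilde n α h b := by
  rcases eq_or_ne t 0 with rfl | ht0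
  · simp
  rcases eq_or_ne (1 - t) 0 with ht1 | ht1
  · have : t = 1 := le_antisymm ht (tsub_eq_zero_iff_le.1 ht1)
    subst this
    simp
  set t' := 1 - t with ht'
  have htt : t + t' = 1 := add_tsub_cancel_of_le ht
  have htR : (t : ℝ) + t' = 1 := by exact_mod_cast htt
  have h1 : ∀ (s : ℝ≥0) (y : ℝ≥0) , s ≠ 0 → (s : ℝ≥0∞) * NhTilde n α h y =
      ⨅ (u : ℝ) (_ : 0 < u ∧ (y : ℝ≥0∞) ≤ PhiTilde n α h u), s * ENNReal.ofReal u := by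
    intro s y hs
    unfold NhTilde
    rw [ENNReal.mul_iInf_of_ne (by exact_mod_cast hs) ENNReal.coe_ne_top]
    congr 1
    funext u
    rw [ENNReal.mul_iInf_of_ne (by exact_mod_cast hs) ENNReal.coe_ne_top]
  rw [h1 t a ht0, h1 t' b ht1]
  simp_rw [ENNReal.iInf_add, ENNReal.add_iInf]
  refine le_iInf₂ fun u hu => le_iInf₂ fun w hw => ?_
  have ht0' : (0 : ℝ) < t := by exact_mod_cast pos_iff_ne_zero.2 ht0
  have ht1' : (0 : ℝ) < t' := by exact_mod_cast pos_iff_ne_zero.2 ht1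
  have hu0 := hu.1
  have hw0 := hw.1
  set z : ℝ := t * u + t' * w with hz
  have hz0 : 0 < z := by positivity
  have ez : ENNReal.ofReal z = t * ENNReal.ofReal u + t' * ENNReal.ofReal w := by
    rw [hz, ENNReal.ofReal_add (by positivity) (by positivity), ENNReal.ofReal_mul ht0'.le,
      ENNReal.ofReal_mul ht1'.le, ENNReal.ofReal_coe_nnreal, ENNReal.ofReal_coe_nnreal]
  rw [← ez]
  unfold NhTilde
  refine iInf₂_le z ⟨hz0, ?_⟩
  obtain ⟨c, hc⟩ := PhiTilde_line n α hα h hΦ z hz0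
  have c1 := hc u hu0.le
  have c2 := hc w hw0.le
  have httE : (t : ℝ≥0∞) + t' = 1 := by exact_mod_cast htt
  have hfin : (c : ℝ≥0∞) * ENNReal.ofReal z ≠ ∞ :=
    ENNReal.mul_ne_top ENNReal.coe_ne_top ENNReal.ofReal_ne_top
  refine (ENNReal.add_le_add_iff_right hfin).1 ?_
  push_cast
  calc (t : ℝ≥0∞) * a + t' * b + c * ENNReal.ofReal z
      ≤ t * PhiTilde n α h u + t' * PhiTilde n α h w + c * ENNReal.ofReal z := by
        gcongr
        · exact hu.2
        · exact hw.2
    _ = t * PhiTilde n α h u + t' * PhiTilde n α h w +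
          ((t : ℝ≥0∞) + t') * (c * ENNReal.ofReal z) := by rw [httE, one_mul]
    _ = t * (PhiTilde n α h u + c * ENNReal.ofReal z) +
          t' * (PhiTilde n α h w + c * ENNReal.ofReal z) := by ring
    _ ≤ t * (PhiTilde n α h z + c * ENNReal.ofReal u) +
          t' * (PhiTilde n α h z + c * ENNReal.ofReal w) := by gcongr
    _ = ((t : ℝ≥0∞) + t') * PhiTilde n α h z +
          c * (t * ENNReal.ofReal u + t' * ENNReal.ofReal w) := by ring
    _ = _ := by rw [httE, one_mul, ez]

lemma NhTilde_tendsto (n : ℕ) (α : ℝ) (h : ℝ → ℝ)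
    (hΦ : ∀ s : ℝ, 0 < s → PhiTilde n α h s < ∞) :
    Tendsto (NhTilde n α h) atTop (nhds ⊤) := by
  rw [ENNReal.tendsto_nhds_top_iff_nnreal]
  intro x
  set w : ℝ := (x : ℝ) + 1
  have hw : 0 < w := by positivity
  filter_upwards [eventually_gt_atTop (PhiTilde n α h w).toNNReal] with s hs
  have hs' : PhiTilde n α h w < s := by
    rw [← ENNReal.coe_toNNReal (hΦ w hw).ne]
    exact_mod_cast hs
  refine lt_of_lt_of_le (b := ENNReal.ofReal w) ?_ ?_
  · rw [← ENNReal.ofReal_coe_nnreal]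
    exact (ENNReal.ofReal_lt_ofReal_iff hw).2 (by simp [w])
  · unfold NhTilde
    refine le_iInf₂ fun u hu => ENNReal.ofReal_le_ofReal ?_
    by_contra hlt
    push Not at hlt
    have : PhiTilde n α h u ≤ PhiTilde n α h w := by
      rw [PhiTilde_eq, PhiTilde_eq]
      exact lintegral_mono_set (Ioo_subset_Ioo_right hlt.le)
    exact absurd (hu.2.trans this) (not_le.2 hs')

lemma rpow_tangent (a : ℝ) (ha0 : 0 < a) (ha1 : a < 1) (u t : ℝ) (hu : 0 < u) (ht : 0 ≤ t) :
    t ^ (1 - a) + (1 - a) * u ^ (-a) * u ≤ u ^ (1 - a) + (1 - a) * u ^ (-a) * t := by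
  have h1 := Real.geom_mean_le_arith_mean2_weighted (w₁ := 1 - a) (w₂ := a) (p₁ := t) (p₂ := u)
    (by linarith) ha0.le ht hu.le (by ring)
  have e1 : u ^ (-a) * u ^ a = 1 := by rw [← Real.rpow_add hu]; simp
  have e2 : u ^ (1 - a) = u ^ (-a) * u := by
    rw [show 1 - a = -a + 1 by ring, Real.rpow_add_one hu.ne']
  have h2 : 0 < u ^ (-a) := Real.rpow_pos_of_pos hu _
  have h3 := mul_le_mul_of_nonneg_left h1 h2.le
  have h4 : u ^ (-a) * (t ^ (1 - a) * u ^ a) = t ^ (1 - a) := by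
    calc _ = t ^ (1 - a) * (u ^ (-a) * u ^ a) := by ring
      _ = _ := by rw [e1, mul_one]
  rw [h4] at h3
  rw [e2]
  linarith

lemma trunc_part (n : ℕ) (hn : 2 ≤ n) (α : ℝ) (hα : α ∈ Ioo (0 : ℝ) 2) :
    (∃ C : ℝ, 0 < C ∧
      ∀ f : EuclideanSpace ℝ (Fin n) → ℝ, Measurable f →
        orliczNorm volume (Ntrunc n α) f < ∞ →
        orliczNorm volume (Ntrunc n α) f ≤ ENNReal.ofReal C *
          ∫⁻ x, (∫⁻ y in Metric.closedBall x 1, (‖f x - f y‖₊ : ℝ≥0∞) *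
            ENNReal.ofReal (1 / dist x y ^ ((n : ℝ) + α / 2)))) := by
  have hα0 := hα.1
  have hα2 := hα.2
  have hn' : (2 : ℝ) ≤ n := by exact_mod_cast hn
  have hn0 : (0 : ℝ) < n := by linarith
  set h0 : ℝ → ℝ := fun s => max (s ^ (α / 2)) s with hh0
  set a : ℝ := 1 / n with ha
  set b : ℝ := α / 2 / n with hb
  have ha0 : 0 < a := by positivity
  have ha1 : a < 1 := by rw [ha, div_lt_one hn0]; linarith
  have hb0 : 0 < b := by positivity
  have hb1 : b < 1 := by rw [hb, div_lt_one hn0]; linarith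
  have hpos0 : ∀ s : ℝ, 0 < s → 0 < h0 s := fun s hs => lt_max_of_lt_right hs
  have hm0 : MonotoneOn h0 (Ioi (0 : ℝ)) := by
    intro s hs t _ hst
    exact max_le_max (Real.rpow_le_rpow (le_of_lt hs) hst (by positivity)) hst
  have hm0' : MonotoneOn (fun s => s / h0 s) (Ioi (0 : ℝ)) := by
    intro s hs t ht hst
    have hs0 : 0 < s := hs
    have ht0 : 0 < t := ht
    change s / h0 s ≤ t / h0 t
    rw [div_le_div_iff₀ (hpos0 s hs) (hpos0 t ht)]
    have e : ∀ c : ℝ, 0 < c → c = c ^ (1 - α / 2) * c ^ (α / 2) := by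
      intro c hc
      rw [← Real.rpow_add hc]; simp
    have h1 : s * t ^ (α / 2) ≤ t * s ^ (α / 2) := by
      have q1 : s ^ (1 - α / 2) ≤ t ^ (1 - α / 2) :=
        Real.rpow_le_rpow hs0.le hst (by linarith)
      have p1 : 0 < s ^ (α / 2) := Real.rpow_pos_of_pos hs0 _
      have p2 : 0 < t ^ (α / 2) := Real.rpow_pos_of_pos ht0 _
      calc s * t ^ (α / 2) = s ^ (1 - α / 2) * (s ^ (α / 2) * t ^ (α / 2)) := by
            conv_lhs => rw [e s hs0]
            ring
        _ ≤ t ^ (1 - α / 2) * (s ^ (α / 2) * t ^ (α / 2)) := by gcongr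
        _ = t * s ^ (α / 2) := by
            conv_rhs => rw [e t ht0]
            ring
    rw [hh0]
    simp only
    rw [mul_max_of_nonneg _ _ hs0.le]
    refine max_le (h1.trans ?_) ?_
    · exact mul_le_mul_of_nonneg_left (le_max_left _ _) ht0.le
    · rw [mul_comm]
      exact mul_le_mul_of_nonneg_left (le_max_right _ _) ht0.le
  set Φ : ℝ → ℝ≥0∞ := fun t => ENNReal.ofReal ((t ^ (1 - a) + t ^ (1 - b)) / 2) with hΦ
  have e1 : 0 < (n : ℝ) / ((n : ℝ) - α / 2) := div_pos hn0 (by linarith)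
  have e2 : 0 < (n : ℝ) / ((n : ℝ) - 1) := div_pos hn0 (by linarith)
  obtain ⟨C, hC, hmain⟩ := main_abstract n hn α hα h0 hpos0 hm0 hm0' Φ (Ntrunc n α) 2 two_pos
    (by
      rw [hΦ]
      simp only
      rw [Real.zero_rpow (by linarith), Real.zero_rpow (by linarith)]
      simp)
    (by
      intro u hu
      have hc : 0 ≤ ((1 - a) * u ^ (-a) + (1 - b) * u ^ (-b)) / 2 := by
        have p1 : 0 < u ^ (-a) := Real.rpow_pos_of_pos hu _
        have p2 : 0 < u ^ (-b) := Real.rpow_pos_of_pos hu _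
        have : 0 < 1 - a := by linarith
        have : 0 < 1 - b := by linarith
        positivity
      refine ⟨Real.toNNReal (((1 - a) * u ^ (-a) + (1 - b) * u ^ (-b)) / 2), fun t ht => ?_⟩
      change _ + ENNReal.ofReal _ * _ ≤ _ + ENNReal.ofReal _ * _
      have p1 : 0 ≤ t ^ (1 - a) := Real.rpow_nonneg ht _
      have p2 : 0 ≤ t ^ (1 - b) := Real.rpow_nonneg ht _
      have p3 : 0 ≤ u ^ (1 - a) := Real.rpow_nonneg hu.le _
      have p4 : 0 ≤ u ^ (1 - b) := Real.rpow_nonneg hu.le _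
      rw [hΦ]
      simp only
      rw [← ENNReal.ofReal_mul hc, ← ENNReal.ofReal_mul hc,
        ← ENNReal.ofReal_add (by positivity) (by positivity),
        ← ENNReal.ofReal_add (by positivity) (by positivity)]
      apply ENNReal.ofReal_le_ofReal
      have t1 := rpow_tangent a ha0 ha1 u t hu ht
      have t2 := rpow_tangent b hb0 hb1 u t hu ht
      linarith)
    (by
      intro ρ hρ
      rw [hΦ]
      simp only
      rw [← ENNReal.ofReal_mul zero_le_two]
      apply ENNReal.ofReal_le_ofReal
      have hv : 0 < ρ ^ n := by positivity
      have e : ∀ c : ℝ, ((ρ ^ n)⁻¹) ^ (1 - c / n) = (ρ ^ n)⁻¹ * ρ ^ c := by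
        intro c
        rw [Real.rpow_sub (inv_pos.2 hv), Real.rpow_one, Real.inv_rpow hv.le,
          ← Real.rpow_natCast, ← Real.rpow_mul hρ.le, mul_div_cancel₀ _ hn0.ne', div_inv_eq_mul]
      rw [ha, hb, e, e, Real.rpow_one]
      have y0 : 0 < ρ ^ (α / 2) := Real.rpow_pos_of_pos hρ _
      have ey : ρ ^ α = (ρ ^ (α / 2)) ^ 2 := by
        rw [← Real.rpow_natCast, ← Real.rpow_mul hρ.le]; congr 1; push_cast; ring
      rw [ey, hh0]
      simp only
      set y := ρ ^ (α / 2)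
      have hM : 0 < max y ρ := lt_max_of_lt_right hρ
      have m1 : y ≤ max y ρ := le_max_left _ _
      have m2 : ρ ≤ max y ρ := le_max_right _ _
      rw [div_le_iff₀ (by positivity)]
      have : 2 * (((ρ ^ n)⁻¹ * ρ + (ρ ^ n)⁻¹ * y) / 2) * (ρ ^ n * max y ρ) =
          (ρ + y) * max y ρ := by field_simp
      rw [this]
      refine max_le ?_ ?_ <;> nlinarith)
    (by
      intro s hs
      have : (0 : ℝ≥0∞) < s := by exact_mod_cast hs
      exact lt_min (ENNReal.rpow_pos this ENNReal.coe_ne_top)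
        (ENNReal.rpow_pos this ENNReal.coe_ne_top))
    (by
      intro s t hst
      have : (s : ℝ≥0∞) ≤ t := by exact_mod_cast hst
      exact min_le_min (ENNReal.rpow_le_rpow this e1.le) (ENNReal.rpow_le_rpow this e2.le))
    (by
      intro u s hu hs
      have hle : (s : ℝ≥0∞) ≤ ENNReal.ofReal (max (u ^ (1 - a)) (u ^ (1 - b))) := by
        refine hs.trans (ENNReal.ofReal_le_ofReal ?_)
        have := le_max_left (u ^ (1 - a)) (u ^ (1 - b))
        have := le_max_right (u ^ (1 - a)) (u ^ (1 - b))
        linarith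
      have gen : ∀ c d : ℝ, 0 < d → c * d = 1 → (s : ℝ≥0∞) ≤ ENNReal.ofReal (u ^ c) →
          (s : ℝ≥0∞) ^ d ≤ ENNReal.ofReal u := by
        intro c d hd hcd hsc
        calc (s : ℝ≥0∞) ^ d ≤ (ENNReal.ofReal (u ^ c)) ^ d := ENNReal.rpow_le_rpow hsc hd.le
          _ = ENNReal.ofReal ((u ^ c) ^ d) :=
            ENNReal.ofReal_rpow_of_pos (Real.rpow_pos_of_pos hu _)
          _ = _ := by rw [← Real.rpow_mul hu.le, hcd, Real.rpow_one]
      have n1 : (n : ℝ) - 1 ≠ 0 := by linarith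
      have n2 : (n : ℝ) - α / 2 ≠ 0 := by linarith
      have n3 : (n : ℝ) * 2 - α ≠ 0 := by linarith
      rcases le_total (u ^ (1 - a)) (u ^ (1 - b)) with hx | hx
      · rw [max_eq_right hx] at hle
        refine (min_le_left _ _).trans (gen (1 - b) _ e1 ?_ hle)
        have : 1 - b = (n - α / 2) / n := by rw [hb]; field_simp
        rw [this, div_mul_div_comm, mul_comm, div_self (mul_ne_zero hn0.ne' n2)]
      · rw [max_eq_left hx] at hle
        refine (min_le_right _ _).trans (gen (1 - a) _ e2 ?_ hle)
        have : 1 - a = (n - 1) / n := by rw [ha]; field_simp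
        rw [this, div_mul_div_comm, mul_comm, div_self (mul_ne_zero hn0.ne' n1)])
  refine ⟨C, hC, fun f hf hfin => (hmain f hf hfin).trans (le_of_eq ?_)⟩
  congr 1
  refine lintegral_congr fun x => ?_
  refine setLIntegral_congr_fun measurableSet_closedBall fun y hy => ?_
  rw [Metric.mem_closedBall, dist_comm] at hy
  rcases eq_or_ne x y with rfl | hxy
  · simp
  · have hd : 0 < dist x y := dist_pos.2 hxy
    congr 2
    have hmax : h0 (dist x y) = dist x y ^ (α / 2) := by
      refine max_eq_left ?_
      have := Real.rpow_le_rpow_of_exponent_ge hd hy (show α / 2 ≤ 1 by linarith)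
      rwa [Real.rpow_one] at this
    rw [hmax, show (n : ℝ) + α = α / 2 + (n + α / 2) by ring, Real.rpow_add hd (α / 2)]
    have : dist x y ^ (α / 2) ≠ 0 := (Real.rpow_pos_of_pos hd _).ne'
    rw [← div_div, div_self this]

end Aux

/-- the Orlicz–Sobolev type isoperimetric inequality for the
truncated `α`-stable kernel: `Ñ_h = Φ̃_h⁻¹` is a Young function and the `L¹`
Orlicz–Sobolev inequality over `{|x-y| ≤ 1}` holds; in particular it holds for
`Ñ_α(s) = s^{n/(n-α/2)} ∧ s^{n/(n-1)}`. -/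
theorem orliczSobolev_truncated_stable
    (n : ℕ) (hn : 2 ≤ n) (α : ℝ) (hα : α ∈ Ioo (0 : ℝ) 2)
    (h : ℝ → ℝ) (hpos : ∀ s : ℝ, 0 < s → 0 < h s)
    (hmono : MonotoneOn h (Ioi (0 : ℝ)))
    (hmono' : MonotoneOn (fun s => s / h s) (Ioi (0 : ℝ)))
    (hΦ : ∀ s : ℝ, 0 < s → PhiTilde n α h s < ∞) :
    (∃ NY : YoungFunction, NY.toFun = NhTilde n α h) ∧
    (∃ C : ℝ, 0 < C ∧
      ∀ f : EuclideanSpace ℝ (Fin n) → ℝ, Measurable f →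
        orliczNorm volume (NhTilde n α h) f < ∞ →
        orliczNorm volume (NhTilde n α h) f ≤ ENNReal.ofReal C *
          ∫⁻ x, (∫⁻ y in Metric.closedBall x 1, (‖f x - f y‖₊ : ℝ≥0∞) *
            ENNReal.ofReal (h (dist x y) / dist x y ^ ((n : ℝ) + α)))) ∧
    (∃ C : ℝ, 0 < C ∧
      ∀ f : EuclideanSpace ℝ (Fin n) → ℝ, Measurable f →
        orliczNorm volume (Ntrunc n α) f < ∞ →
        orliczNorm volume (Ntrunc n α) f ≤ ENNReal.ofReal C *
          ∫⁻ x, (∫⁻ y in Metric.closedBall x 1, (‖f x - f y‖₊ : ℝ≥0∞) *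
            ENNReal.ofReal (1 / dist x y ^ ((n : ℝ) + α / 2)))) := by
  refine ⟨⟨⟨NhTilde n α h, NhTilde_zero n α h, NhTilde_mono n α h,
    NhTilde_convex n α hα h hΦ, NhTilde_tendsto n α h hΦ⟩, rfl⟩, ?_, trunc_part n hn α hα⟩
  refine main_abstract n hn α hα h hpos hmono hmono' (PhiTilde n α h) (NhTilde n α h) 1 one_pos
    (PhiTilde_zero n α h) (PhiTilde_line n α hα h hΦ) ?_ (NhTilde_pos n α h hΦ)
    (NhTilde_mono n α h) ?_
  · intro ρ hρ
    rw [ENNReal.ofReal_one, one_mul]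
    exact PhiTilde_low n hn α hα h hpos hmono ρ hρ
  · intro u s hu hs
    exact iInf₂_le u ⟨hu, hs⟩
end
end

section
/- Let n ≥ 2 be an integer and α ∈ (0,2). Let W : ℝⁿ → ℝ be measurable such that μ_W(dx) := e^{−W(x)} dx is a probability measure, and set Φ(l) := inf_{|x| ≥ l} e^{W(x)} / |x|^{n+α/2} for l ≥ 1 (Φ is nondecreasing, so lim_{l→∞} Φ(l) exists in [0,∞]). If lim_{l→∞} Φ(l) > 0, then there exist constants c₁, c₂ > 0 such that for every f ∈ C_c^∞(ℝⁿ): ∫_{ℝⁿ} f(x)² μ_W(dx) ≤ c₁ ∫_{ℝⁿ} ∫_{ℝⁿ} |f²(x) − f²(y)| / |x−y|^{n+α/2} dy μ_W(dx) + c₂ ( ∫_{ℝⁿ} |f(x)| μ_W(dx) )². -/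
open MeasureTheory ENNReal NNReal Filter Set

noncomputable section


lemma aux_sq (a b : ℝ) : (‖a‖₊ : ℝ≥0∞) ^ 2 ≤ (‖a ^ 2 - b ^ 2‖₊ : ℝ≥0∞) + ‖a‖₊ * ‖b‖₊ := by
  have h : ‖a‖₊ ^ 2 ≤ ‖a ^ 2 - b ^ 2‖₊ + ‖a‖₊ * ‖b‖₊ := by
    rw [← NNReal.coe_le_coe]
    push_cast
    simp only [Real.norm_eq_abs]
    rcases le_total |a| |b| with h | h
    · nlinarith [abs_nonneg a, abs_nonneg (a ^ 2 - b ^ 2)]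
    · have := le_abs_self (a ^ 2 - b ^ 2)
      nlinarith [abs_nonneg b, sq_abs a, sq_abs b]
  exact_mod_cast h

/-- The double integral of the pointwise estimate against a product weight. -/
lemma aux_double {E : Type*} [MeasurableSpace E] (μ : Measure E) (F w a b : E → ℝ≥0∞)
    (Q D k : E → E → ℝ≥0∞) (K : ℝ≥0∞) (hK : K ≠ ∞)
    (hF : Measurable F) (ha : Measurable a) (hb : Measurable b)
    (haw : ∀ x, a x ≤ w x) (hbw : ∀ x, b x ≤ w x)
    (hQ : ∀ x y, Q x y ≤ D x y + F x * F y)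
    (hD : ∀ x y, D x y * (a x * b y) ≤ K * (w x * (D x y * k x y)))
    (hw : ∀ x, w x ≠ ∞) :
    ∫⁻ x, ∫⁻ y, Q x y * (a x * b y) ∂μ ∂μ ≤
      K * (∫⁻ x, w x * ∫⁻ y, D x y * k x y ∂μ ∂μ) + (∫⁻ x, w x * F x ∂μ) ^ 2 := by
  have hbF : Measurable fun y => b y * F y := hb.mul hF
  have haF : Measurable fun y => a y * F y := ha.mul hF
  have h1' : ∀ x, ∫⁻ y, Q x y * (a x * b y) ∂μ ≤
      K * (w x * ∫⁻ y, D x y * k x y ∂μ) + (a x * F x) * ∫⁻ y, b y * F y ∂μ := by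
    intro x
    calc ∫⁻ y, Q x y * (a x * b y) ∂μ
        ≤ ∫⁻ y, (K * (w x * (D x y * k x y)) + (a x * F x) * (b y * F y)) ∂μ := by
          apply lintegral_mono
          intro y
          calc Q x y * (a x * b y) ≤ (D x y + F x * F y) * (a x * b y) := by
                gcongr; exact hQ x y
            _ = D x y * (a x * b y) + (a x * F x) * (b y * F y) := by ring
            _ ≤ _ := add_le_add_left (hD x y) _
      _ = K * (w x * ∫⁻ y, D x y * k x y ∂μ) + (a x * F x) * ∫⁻ y, b y * F y ∂μ := by
          rw [lintegral_add_right _ (hbF.const_mul _), lintegral_const_mul' _ _ hK,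
            lintegral_const_mul' _ _ (hw x), lintegral_const_mul _ hbF]
  calc ∫⁻ x, ∫⁻ y, Q x y * (a x * b y) ∂μ ∂μ
      ≤ ∫⁻ x, (K * (w x * ∫⁻ y, D x y * k x y ∂μ) + (a x * F x) * ∫⁻ y, b y * F y ∂μ) ∂μ :=
        lintegral_mono h1'
    _ = K * (∫⁻ x, w x * ∫⁻ y, D x y * k x y ∂μ ∂μ)
        + (∫⁻ x, a x * F x ∂μ) * ∫⁻ y, b y * F y ∂μ := by
        rw [lintegral_add_right _ (haF.mul_const _), lintegral_const_mul' _ _ hK,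
          lintegral_mul_const _ haF]
    _ ≤ K * (∫⁻ x, w x * ∫⁻ y, D x y * k x y ∂μ ∂μ)
        + (∫⁻ x, w x * F x ∂μ) * ∫⁻ y, w y * F y ∂μ := by
        gcongr with y y
        · exact haw y
        · exact hbw y
    _ = _ := by rw [sq]

/-- for `n ≥ 2`, `α ∈ (0,2)` and a weight `W` with
`μ_W(dx) = e^{-W(x)} dx` a probability measure, if
`lim_{l→∞} inf_{|x|≥l} e^{W(x)}/|x|^{n+α/2} > 0` (the limit being the
supremum over `l ≥ 1` of the nondecreasing function `Φ`), then the `L¹`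
Poincaré type inequality holds for the `α/2`-stable-like form with reference
measure `μ_W`, for all `f ∈ C_c^∞(ℝⁿ)`. -/
theorem poincare_type_stable_like_weighted
    (n : ℕ) (hn : 2 ≤ n) (α : ℝ) (hα : α ∈ Ioo (0 : ℝ) 2)
    (W : EuclideanSpace ℝ (Fin n) → ℝ) (hW : Measurable W)
    (hprob : (∫⁻ x, ENNReal.ofReal (Real.exp (-W x))) = 1)
    (hΦ : 0 < ⨆ (l : ℝ) (_ : (1 : ℝ) ≤ l),
      ⨅ (x : EuclideanSpace ℝ (Fin n)) (_ : l ≤ ‖x‖),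
        ENNReal.ofReal (Real.exp (W x) / ‖x‖ ^ ((n : ℝ) + α / 2))) :
    ∃ c₁ c₂ : ℝ, 0 < c₁ ∧ 0 < c₂ ∧
      ∀ f : EuclideanSpace ℝ (Fin n) → ℝ,
        ContDiff ℝ (⊤ : ℕ∞) f → HasCompactSupport f →
        (∫⁻ x, (‖f x‖₊ : ℝ≥0∞) ^ 2
            ∂(volume.withDensity fun x => ENNReal.ofReal (Real.exp (-W x)))) ≤
          ENNReal.ofReal c₁ *
            (∫⁻ x, (∫⁻ y, (‖f x ^ 2 - f y ^ 2‖₊ : ℝ≥0∞) *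
                ENNReal.ofReal (1 / dist x y ^ ((n : ℝ) + α / 2)))
              ∂(volume.withDensity fun x => ENNReal.ofReal (Real.exp (-W x))))
          + ENNReal.ofReal c₂ *
            (∫⁻ x, (‖f x‖₊ : ℝ≥0∞)
              ∂(volume.withDensity fun x => ENNReal.ofReal (Real.exp (-W x)))) ^ 2 := by
  obtain ⟨hα0, hα2⟩ := hα
  simp only [lt_iSup_iff] at hΦ
  obtain ⟨R, hR, hΦ⟩ := hΦ
  obtain ⟨δ, hδ0, hδ⟩ := ENNReal.lt_iff_exists_nnreal_btwn.1 hΦ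
  have hδ0 : 0 < (δ : ℝ) := by exact_mod_cast hδ0
  set p : ℝ := (n : ℝ) + α / 2 with hp
  have hp0 : 0 < p := by positivity
  have hδW : ∀ x : EuclideanSpace ℝ (Fin n), R ≤ ‖x‖ → δ * ‖x‖ ^ p ≤ Real.exp (W x) := by
    intro x hx
    have h1 : (δ : ℝ≥0∞) ≤ ENNReal.ofReal (Real.exp (W x) / ‖x‖ ^ p) :=
      hδ.le.trans (iInf₂_le x hx)
    rw [← ENNReal.ofReal_coe_nnreal, ENNReal.ofReal_le_ofReal_iff (by positivity)] at h1
    have hx0 : 0 < ‖x‖ := by linarith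
    rwa [le_div_iff₀ (by positivity)] at h1
  set w : EuclideanSpace ℝ (Fin n) → ℝ≥0∞ := fun x => ENNReal.ofReal (Real.exp (-W x)) with hw
  have hwm : Measurable w := by fun_prop
  have hwt : ∀ x, w x ≠ ∞ := fun x => ENNReal.ofReal_ne_top
  set B : Set (EuclideanSpace ℝ (Fin n)) := Metric.ball 0 R with hB
  have hBm : MeasurableSet B := measurableSet_ball
  set v : EuclideanSpace ℝ (Fin n) → ℝ≥0∞ := B.indicator (fun x => min (w x) 1) with hv
  have hvm : Measurable v := (hwm.min measurable_const).indicator hBm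
  have hvw : ∀ x, v x ≤ w x := fun x =>
    (Set.indicator_le_self _ _ x).trans (min_le_left _ _)
  have hv1 : ∀ x, v x ≤ 1 := fun x =>
    (Set.indicator_le_self _ _ x).trans (min_le_right _ _)
  have hvB : ∀ x, x ∉ B → v x = 0 := fun x hx => Set.indicator_of_notMem hx _
  set m : ℝ≥0∞ := ∫⁻ x, v x with hm
  have hmt : m ≠ ∞ := ne_top_of_le_ne_top ENNReal.one_ne_top (hprob ▸ lintegral_mono hvw)
  have hm0 : m ≠ 0 := by
    intro h
    rw [hm, lintegral_indicator hBm, setLIntegral_eq_zero_iff hBm (hwm.min measurable_const)] at h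
    have h2 : volume B = 0 := by
      refine measure_mono_null ?_ (ae_iff.1 h)
      intro x hx
      have : 0 < w x := ENNReal.ofReal_pos.2 (Real.exp_pos _)
      simp only [Set.mem_ofPred_eq, Classical.not_imp]
      refine ⟨hx, ?_⟩
      exact (lt_min this one_pos).ne'
    exact (Metric.measure_ball_pos volume (0 : EuclideanSpace ℝ (Fin n)) (by linarith)).ne' h2
  set K : ℝ := (2 * R) ^ p + 2 ^ p / δ with hK
  have hK0 : 0 < K := by positivity
  -- pointwise kernel bounds
  have hk1 : ∀ x y, x ∈ B → y ∈ B → x ≠ y → 1 ≤ K * (1 / dist x y ^ p) := by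
    intro x y hx hy hxy
    have h0 : 0 < dist x y := dist_pos.2 hxy
    have hd : dist x y ≤ 2 * R := by
      have h1 := dist_triangle_right x y 0
      have h2 : dist x 0 < R := hx
      have h3 : dist y 0 < R := hy
      linarith
    rw [mul_one_div, le_div_iff₀ (by positivity), one_mul]
    have := Real.rpow_le_rpow h0.le hd hp0.le
    have h5 : 0 ≤ (2 : ℝ) ^ p / δ := by positivity
    linarith
  have hk2 : ∀ x y, x ∈ B → y ∉ B → x ≠ y → Real.exp (-W y) ≤ K * (1 / dist x y ^ p) := by
    intro x y hx hy hxy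
    have h0 : 0 < dist x y := dist_pos.2 hxy
    have h3 : R ≤ ‖y‖ := by simpa [hB] using hy
    have hd : dist x y ≤ 2 * ‖y‖ := by
      have h1 := dist_triangle_right x y 0
      have h2 : dist x 0 < R := hx
      have h4 : dist y 0 = ‖y‖ := dist_zero_right y
      linarith
    have h5 := Real.rpow_le_rpow h0.le hd hp0.le
    rw [Real.mul_rpow (by norm_num) (norm_nonneg _)] at h5
    have h6 := hδW y h3
    rw [mul_one_div, le_div_iff₀ (by positivity), Real.exp_neg, inv_mul_le_iff₀ (Real.exp_pos _)]
    have h7 : (2 : ℝ) ^ p / δ ≤ K := by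
      have : 0 ≤ (2 * R) ^ p := by positivity
      linarith
    calc dist x y ^ p ≤ 2 ^ p * ‖y‖ ^ p := h5
      _ = (δ * ‖y‖ ^ p) * (2 ^ p / δ) := by field_simp
      _ ≤ Real.exp (W y) * K := by gcongr
  refine ⟨2 * K / m.toReal, 2 / m.toReal, ?_, ?_, ?_⟩
  · have := ENNReal.toReal_pos hm0 hmt
    positivity
  · have := ENNReal.toReal_pos hm0 hmt
    positivity
  intro f hf _
  have hfm : Measurable f := hf.continuous.measurable
  have hwae : ∀ᵐ x, w x < ∞ := Eventually.of_forall fun x => (hwt x).lt_top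
  simp only [lintegral_withDensity_eq_lintegral_mul_non_measurable _ hwm hwae, Pi.mul_apply]
  set F : EuclideanSpace ℝ (Fin n) → ℝ≥0∞ := fun x => (‖f x‖₊ : ℝ≥0∞) with hF
  have hFm : Measurable F := by fun_prop
  set D : EuclideanSpace ℝ (Fin n) → EuclideanSpace ℝ (Fin n) → ℝ≥0∞ :=
    fun x y => (‖f x ^ 2 - f y ^ 2‖₊ : ℝ≥0∞) with hD
  set k : EuclideanSpace ℝ (Fin n) → EuclideanSpace ℝ (Fin n) → ℝ≥0∞ :=
    fun x y => ENNReal.ofReal (1 / dist x y ^ p) with hk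
  set I : ℝ≥0∞ := ∫⁻ x, w x * F x with hI
  set En : ℝ≥0∞ := ∫⁻ x, w x * ∫⁻ y, D x y * k x y with hEn
  have hDxx : ∀ x, D x x = 0 := by intro x; simp [hD]
  have hwB : Measurable (B.indicator w) := hwm.indicator hBm
  have hwBc : Measurable (Bᶜ.indicator w) := hwm.indicator hBm.compl
  have hKk1 : ∀ x y, x ∈ B → y ∈ B → x ≠ y → 1 ≤ ENNReal.ofReal K * k x y := by
    intro x y hx hy hxy
    rw [hk, ← ENNReal.ofReal_mul hK0.le, ENNReal.one_le_ofReal]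
    exact hk1 x y hx hy hxy
  have hKk2 : ∀ x y, x ∈ B → y ∉ B → x ≠ y → w y ≤ ENNReal.ofReal K * k x y := by
    intro x y hx hy hxy
    rw [hk, ← ENNReal.ofReal_mul hK0.le]
    exact ENNReal.ofReal_le_ofReal (hk2 x y hx hy hxy)
  have e1 := aux_double volume F w (B.indicator w) v (fun x _ => F x ^ 2) D k (ENNReal.ofReal K)
    ENNReal.ofReal_ne_top hFm hwB hvm (fun x => Set.indicator_le_self _ _ x) hvw
    (fun x y => aux_sq (f x) (f y)) (by
      intro x y
      by_cases hxy : x = y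
      · subst hxy; simp [hDxx]
      by_cases hx : x ∈ B
      swap
      · simp [hx]
      by_cases hy : y ∈ B
      swap
      · simp [hvB y hy]
      rw [Set.indicator_of_mem hx]
      calc D x y * (w x * v y) ≤ D x y * (w x * (ENNReal.ofReal K * k x y)) := by
            gcongr
            exact (hv1 y).trans (hKk1 x y hx hy hxy)
        _ = _ := by ring) hwt
  have e2 := aux_double volume F w v (Bᶜ.indicator w) (fun _ y => F y ^ 2) D k (ENNReal.ofReal K)
    ENNReal.ofReal_ne_top hFm hvm hwBc hvw (fun x => Set.indicator_le_self _ _ x)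
    (fun x y => by
      have := aux_sq (f y) (f x)
      rw [mul_comm (F x), hD]
      dsimp only
      rwa [← nnnorm_neg, neg_sub]) (by
      intro x y
      by_cases hxy : x = y
      · subst hxy; simp [hDxx]
      by_cases hx : x ∈ B
      swap
      · simp [hvB x hx]
      by_cases hy : y ∈ B
      · simp [hy]
      rw [Set.indicator_of_mem (by exact hy)]
      calc D x y * (v x * w y) ≤ D x y * (w x * (ENNReal.ofReal K * k x y)) := by
            gcongr
            · exact hvw x
            · exact hKk2 x y hx hy hxy
        _ = _ := by ring) hwt
  have s1 : ∫⁻ x, ∫⁻ y, F x ^ 2 * (B.indicator w x * v y) =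
      m * ∫⁻ x, B.indicator w x * F x ^ 2 := by
    rw [← lintegral_const_mul' _ _ hmt]
    apply lintegral_congr
    intro x
    simp_rw [← mul_assoc]
    rw [lintegral_const_mul _ hvm, ← hm]
    ring
  have s2 : ∫⁻ x, ∫⁻ y, F y ^ 2 * (v x * Bᶜ.indicator w y) =
      m * ∫⁻ x, Bᶜ.indicator w x * F x ^ 2 := by
    rw [hm, ← lintegral_mul_const _ hvm]
    apply lintegral_congr
    intro x
    rw [← lintegral_const_mul _ (show Measurable fun y => Bᶜ.indicator w y * F y ^ 2 from hwBc.mul (hFm.pow_const 2))]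
    apply lintegral_congr
    intro y
    ring
  have s : ∫⁻ x, w x * F x ^ 2 =
      (∫⁻ x, B.indicator w x * F x ^ 2) + ∫⁻ x, Bᶜ.indicator w x * F x ^ 2 := by
    rw [← lintegral_add_left (show Measurable fun y => B.indicator w y * F y ^ 2 from hwB.mul (hFm.pow_const 2))]
    apply lintegral_congr
    intro x
    rw [← add_mul]
    congr 1
    exact (congrFun (Set.indicator_self_add_compl B w) x).symm
  rw [s1] at e1
  rw [s2] at e2
  have e3 : m * ∫⁻ x, w x * F x ^ 2 ≤ 2 * ENNReal.ofReal K * En + 2 * I ^ 2 := by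
    rw [s, mul_add]
    refine (add_le_add e1 e2).trans (le_of_eq ?_)
    ring
  have hmpos := ENNReal.toReal_pos hm0 hmt
  rw [ENNReal.ofReal_div_of_pos hmpos, ENNReal.ofReal_div_of_pos hmpos, ENNReal.ofReal_toReal hmt,
    ENNReal.ofReal_mul (by norm_num), ENNReal.ofReal_ofNat]
  calc ∫⁻ x, w x * F x ^ 2 = m⁻¹ * (m * ∫⁻ x, w x * F x ^ 2) := by
        rw [← mul_assoc, ENNReal.inv_mul_cancel hm0 hmt, one_mul]
    _ ≤ m⁻¹ * (2 * ENNReal.ofReal K * En + 2 * I ^ 2) := by gcongr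
    _ = _ := by rw [div_eq_mul_inv, div_eq_mul_inv]; ring
end
end
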